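/- arXiv:1101.0434 — 11 statements merged into one kernel-verified Lean document; each statement's English description precedes it below -/
import Mathlib

section
/- Assume the n×p real matrix X satisfies the Generic Condition. Then for every y ∈ ℝⁿ and every λ > 0, the LASSO problem min_{b∈ℝ^p} (1/2)‖y − Xb‖₂² + λ‖b‖₁ has a unique solution β̂_λ, and the submatrix X_{T̂_λ} of X formed by the columns indexed by the support T̂_λ of β̂_λ has linearly independent columns. -/
open MeasureTheory ProbabilityTheory Real Matrix
open scoped ENNReal

noncomputable section

/-- The submatrix of the columns of `X` indexed by the finite set `T`. -/
def colSub {n p : ℕ} (X : Matrix (Fin n) (Fin p) ℝ) (T : Finset (Fin p)) :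
    Matrix (Fin n) {j // j ∈ T} ℝ :=
  Matrix.of fun i j => X i j.val

/-- The Generic Condition on the design matrix `X`:
`|⟨X_j, X_I (X_Iᵀ X_I)⁻¹ δ_I⟩| < 1` for every sign vector `δ ∈ {−1,1}^p`,
every `I ⊆ {1,…,p}` such that `X_I` has full column rank, and every `j ∉ I`. -/
def GenericCondition {n p : ℕ} (X : Matrix (Fin n) (Fin p) ℝ) : Prop :=
  ∀ δ : Fin p → ℝ, (∀ j, δ j = 1 ∨ δ j = -1) →
    ∀ I : Finset (Fin p),
      LinearIndependent ℝ (fun j : {x // x ∈ I} => fun i => X i j.val) →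
      ∀ j ∉ I,
        |∑ a, X a j *
          (colSub X I *ᵥ (((colSub X I)ᵀ * colSub X I)⁻¹ *ᵥ fun i : {x // x ∈ I} => δ i.val)) a|
          < 1

/-- The LASSO objective function `(1/2)‖y − Xb‖₂² + λ‖b‖₁`. -/
def lassoCost {n p : ℕ} (X : Matrix (Fin n) (Fin p) ℝ) (y : Fin n → ℝ) (lam : ℝ)
    (b : Fin p → ℝ) : ℝ :=
  (1 / 2) * ∑ i, (y i - X.mulVec b i) ^ 2 + lam * ∑ j, |b j|

lemma equicorr_indep {n p : ℕ} (X : Matrix (Fin n) (Fin p) ℝ) (hGC : GenericCondition X)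
    (u : Fin n → ℝ) :
    LinearIndepOn ℝ (fun (j : Fin p) (i : Fin n) => X i j)
      {j | |∑ a, X a j * u a| = 1} := by
  classical
  obtain ⟨I, hIE, -, hspan, hI⟩ := exists_linearIndepOn_extension
    (K := ℝ) (v := fun (j : Fin p) (i : Fin n) => X i j) (s := ∅)
    (t := {j | |∑ a, X a j * u a| = 1}) (linearIndepOn_empty _ _) (Set.empty_subset _)
  suffices h : {j | |∑ a, X a j * u a| = 1} ⊆ I from hI.mono h
  intro j hj
  by_contra hjI
  obtain ⟨J, rfl⟩ : ∃ J : Finset (Fin p), (J : Set (Fin p)) = I :=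
    ⟨I.toFinite.toFinset, by simp⟩
  have hmem := hspan (Set.mem_image_of_mem _ hj)
  rw [SetLike.mem_coe, Submodule.mem_span_image_finset_iff_exists_fun] at hmem
  obtain ⟨c, hc⟩ := hmem
  have hlin : LinearIndependent ℝ (fun j : {x // x ∈ J} => fun i => X i j.val) := hI
  set δ : Fin p → ℝ := fun k => if k ∈ J then ∑ a, X a k * u a else 1 with hδ
  have hδ1 : ∀ k, δ k = 1 ∨ δ k = -1 := by
    intro k
    by_cases hk : k ∈ J
    · simp only [hδ, hk, if_true]
      have := hIE (Finset.mem_coe.2 hk)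
      exact eq_or_eq_neg_of_abs_eq this
    · simp [hδ, hk]
  have key := hGC δ hδ1 J hlin j (by simpa using hjI)
  set A := colSub X J with hA
  have hAinj : Function.Injective A.mulVec := by
    rw [Matrix.mulVec_injective_iff]
    exact hlin
  have hG : IsUnit (Aᵀ * A) := by
    rw [← Matrix.mulVec_injective_iff_isUnit]
    intro v w hvw
    have h0 : (Aᵀ * A) *ᵥ (v - w) = 0 := by
      rw [Matrix.mulVec_sub]; exact sub_eq_zero.2 hvw
    have h1 : (A *ᵥ (v - w)) ⬝ᵥ (A *ᵥ (v - w)) = 0 := by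
      rw [Matrix.dotProduct_mulVec, ← Matrix.mulVec_transpose, Matrix.mulVec_mulVec, h0,
        zero_dotProduct]
    rw [dotProduct_self_eq_zero, Matrix.mulVec_sub, sub_eq_zero] at h1
    exact hAinj h1
  have hXj : (fun a => X a j) = A *ᵥ c := by
    have hc' : (fun a => X a j) = ∑ i, c i • fun a => X a i.val := hc.symm
    rw [hc']
    ext a
    simp [Matrix.mulVec, dotProduct, hA, colSub, mul_comm]
  have e1 : ∀ w : Fin n → ℝ, ∑ a, X a j * w a = c ⬝ᵥ (Aᵀ *ᵥ w) := by
    intro w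
    have : ∑ a, X a j * w a = (fun a => X a j) ⬝ᵥ w := rfl
    rw [this, hXj, Matrix.dotProduct_mulVec, Matrix.vecMul_transpose]
  have e2 : Aᵀ *ᵥ u = fun i : {x // x ∈ J} => δ i.val := by
    ext i
    simp [Matrix.mulVec, dotProduct, hA, colSub, hδ]
  have hj' : |∑ a, X a j * u a| = 1 := hj
  rw [e1, Matrix.mulVec_mulVec, Matrix.mulVec_mulVec,
    Matrix.mul_nonsing_inv _ ((Matrix.isUnit_iff_isUnit_det _).1 hG), Matrix.one_mulVec,
    ← e2, ← e1, hj'] at key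
  exact lt_irrefl _ key

lemma lasso_exists {n p : ℕ} (X : Matrix (Fin n) (Fin p) ℝ)
    (y : Fin n → ℝ) (lam : ℝ) (hlam : 0 < lam) :
    ∃ b : Fin p → ℝ, ∀ c, lassoCost X y lam b ≤ lassoCost X y lam c := by
  apply Continuous.exists_forall_le
  · unfold lassoCost Matrix.mulVec dotProduct
    fun_prop
  · have h : Filter.Tendsto (fun b : Fin p → ℝ => lam * ‖b‖) (Filter.cocompact _) Filter.atTop :=
      (tendsto_norm_cocompact_atTop).const_mul_atTop hlam
    refine Filter.tendsto_atTop_mono (fun b => ?_) h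
    have h1 : ‖b‖ ≤ ∑ j, |b j| := by
      refine (pi_norm_le_iff_of_nonneg (Finset.sum_nonneg fun _ _ => abs_nonneg _)).2 fun j => ?_
      exact Finset.single_le_sum (f := fun j => |b j|) (fun _ _ => abs_nonneg _)
        (Finset.mem_univ j)
    have h2 : 0 ≤ ∑ i, (y i - X.mulVec b i) ^ 2 := Finset.sum_nonneg fun _ _ => sq_nonneg _
    unfold lassoCost
    nlinarith [mul_le_mul_of_nonneg_left h1 hlam.le]

lemma lasso_fit_unique {n p : ℕ} (X : Matrix (Fin n) (Fin p) ℝ)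
    (y : Fin n → ℝ) (lam : ℝ) (hlam : 0 < lam) (b c : Fin p → ℝ)
    (hb : ∀ d, lassoCost X y lam b ≤ lassoCost X y lam d)
    (hc : ∀ d, lassoCost X y lam c ≤ lassoCost X y lam d) : X *ᵥ b = X *ᵥ c := by
  have hbc : lassoCost X y lam b = lassoCost X y lam c := le_antisymm (hb c) (hc b)
  have hm := hb ((1 / 2 : ℝ) • (b + c))
  have h1 : ∑ j, |((1 / 2 : ℝ) • (b + c)) j| ≤ (1 / 2) * ∑ j, |b j| + (1 / 2) * ∑ j, |c j| := by
    rw [Finset.mul_sum, Finset.mul_sum, ← Finset.sum_add_distrib]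
    refine Finset.sum_le_sum fun j _ => ?_
    have := abs_add_le (b j) (c j)
    simp only [Pi.smul_apply, Pi.add_apply, smul_eq_mul, abs_mul]
    rw [abs_of_pos (by norm_num : (0 : ℝ) < 1 / 2)]
    linarith
  have h2 : ∑ i, (y i - (X *ᵥ ((1 / 2 : ℝ) • (b + c))) i) ^ 2 =
      (1 / 2) * ∑ i, (y i - (X *ᵥ b) i) ^ 2 + (1 / 2) * ∑ i, (y i - (X *ᵥ c) i) ^ 2
        - (1 / 4) * ∑ i, ((X *ᵥ b) i - (X *ᵥ c) i) ^ 2 := by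
    simp only [Finset.mul_sum]
    rw [← Finset.sum_add_distrib, ← Finset.sum_sub_distrib]
    refine Finset.sum_congr rfl fun i _ => ?_
    rw [Matrix.mulVec_smul, Matrix.mulVec_add]
    simp only [Pi.smul_apply, Pi.add_apply, smul_eq_mul]
    ring
  have h3 : ∑ i, ((X *ᵥ b) i - (X *ᵥ c) i) ^ 2 ≤ 0 := by
    unfold lassoCost at hm hbc
    rw [h2] at hm
    have := mul_le_mul_of_nonneg_left h1 hlam.le
    linarith
  have h4 := (Finset.sum_eq_zero_iff_of_nonneg
    (fun i _ => sq_nonneg ((X *ᵥ b) i - (X *ᵥ c) i))).1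
    (le_antisymm h3 (Finset.sum_nonneg fun _ _ => sq_nonneg _))
  ext i
  have := h4 i (Finset.mem_univ i)
  exact sub_eq_zero.1 (pow_eq_zero_iff (two_ne_zero)|>.1 this)

lemma slope_zero (g q m : ℝ) (hm : 0 < m) (hq : 0 ≤ q)
    (h : ∀ t : ℝ, |t| ≤ m → 0 ≤ g * t + q * t ^ 2) : g = 0 := by
  by_contra hg
  have hgpos : 0 < |g| := abs_pos.2 hg
  set e := min (m / |g|) (1 / (2 * (q + 1))) with he
  have he0 : 0 < e := lt_min (by positivity) (by positivity)
  have h1 : e * |g| ≤ m := (le_div_iff₀ hgpos).1 (min_le_left _ _)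
  have h2 : e * (2 * (q + 1)) ≤ 1 := (le_div_iff₀ (by positivity)).1 (min_le_right _ _)
  have h3 := h (-(e * g)) (by rw [abs_neg, abs_mul, abs_of_pos he0]; exact h1)
  have h4 : 0 < e * g ^ 2 := by positivity
  have h5 : g * -(e * g) + q * (-(e * g)) ^ 2 = (e * g ^ 2) * (e * q - 1) := by ring
  rw [h5] at h3
  have := nonneg_of_mul_nonneg_right h3 h4
  nlinarith

lemma lasso_kkt {n p : ℕ} (X : Matrix (Fin n) (Fin p) ℝ)
    (y : Fin n → ℝ) (lam : ℝ) (hlam : 0 < lam) (b : Fin p → ℝ)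
    (hb : ∀ d, lassoCost X y lam b ≤ lassoCost X y lam d) (j : Fin p) (hj : b j ≠ 0) :
    |∑ a, X a j * ((y a - (X *ᵥ b) a) / lam)| = 1 := by
  have hs : ∃ s : ℝ, |s| = 1 ∧ ∀ t : ℝ, |t| ≤ |b j| → |b j + t| = |b j| + s * t := by
    rcases lt_or_gt_of_ne hj with h | h
    · refine ⟨-1, by simp, fun t ht => ?_⟩
      rw [abs_of_neg h] at ht ⊢
      rw [abs_of_nonpos (by linarith [(abs_le.1 ht).2])]
      ring
    · refine ⟨1, by simp, fun t ht => ?_⟩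
      rw [abs_of_pos h] at ht ⊢
      rw [abs_of_nonneg (by linarith [(abs_le.1 ht).1])]
      ring
  obtain ⟨s, hs1, hs⟩ := hs
  have hslope := slope_zero (lam * s - ∑ a, X a j * (y a - (X *ᵥ b) a))
    ((1 / 2) * ∑ a, X a j ^ 2) |b j| (abs_pos.2 hj)
    (mul_nonneg (by norm_num) (Finset.sum_nonneg fun _ _ => sq_nonneg _)) (by
      intro t ht
      have h := hb (b + Pi.single j t)
      have h1 : ∑ k, |(b + Pi.single j t : Fin p → ℝ) k| = ∑ k, |b k| + s * t := by
        have : ∀ k, |(b + Pi.single j t : Fin p → ℝ) k| = |b k| + if k = j then s * t else 0 := by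
          intro k
          by_cases hk : k = j
          · subst hk; simp [hs t ht]
          · simp [hk]
        simp only [this, Finset.sum_add_distrib]
        simp
      have h2 : ∑ i, (y i - (X *ᵥ (b + Pi.single j t)) i) ^ 2 =
          ∑ i, (y i - (X *ᵥ b) i) ^ 2 - 2 * t * ∑ a, X a j * (y a - (X *ᵥ b) a)
            + t ^ 2 * ∑ a, X a j ^ 2 := by
        rw [Finset.mul_sum, Finset.mul_sum, ← Finset.sum_sub_distrib, ← Finset.sum_add_distrib]
        refine Finset.sum_congr rfl fun i _ => ?_
        rw [Matrix.mulVec_add]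
        simp
        ring
      unfold lassoCost at h
      rw [h1, h2] at h
      linarith)
  have h5 : ∑ a, X a j * ((y a - (X *ᵥ b) a) / lam) = s := by
    simp only [← mul_div_assoc]
    rw [← Finset.sum_div, div_eq_iff hlam.ne']
    linarith
  rw [h5, hs1]

/-- Under the Generic Condition, for every `y` and every `λ > 0`,
the LASSO problem has a unique solution `β̂_λ`, and the columns of `X` indexed by the
support of `β̂_λ` are linearly independent. -/
theorem lasso_unique_solution_and_support
    {n p : ℕ} (X : Matrix (Fin n) (Fin p) ℝ) (hGC : GenericCondition X)
    (y : Fin n → ℝ) (lam : ℝ) (hlam : 0 < lam) :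
    ∃ b : Fin p → ℝ,
      (∀ c, lassoCost X y lam b ≤ lassoCost X y lam c) ∧
      (∀ c, (∀ d, lassoCost X y lam c ≤ lassoCost X y lam d) → c = b) ∧
      LinearIndependent ℝ (fun j : {j : Fin p // b j ≠ 0} => fun i => X i j.val) := by
  obtain ⟨b, hb⟩ := lasso_exists X y lam hlam
  have hE := equicorr_indep X hGC (fun a => (y a - (X *ᵥ b) a) / lam)
  refine ⟨b, hb, fun c hc => ?_, ?_⟩
  · have hfit := lasso_fit_unique X y lam hlam c b hc hb
    have hsuppc : ∀ j, c j ≠ 0 → |∑ a, X a j * ((y a - (X *ᵥ b) a) / lam)| = 1 := by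
      intro j hj
      have := lasso_kkt X y lam hlam c hc j hj
      rwa [hfit] at this
    have hsuppb := lasso_kkt X y lam hlam b hb
    have h0 : ∀ j, |∑ a, X a j * ((y a - (X *ᵥ b) a) / lam)| ≠ 1 → c j - b j = 0 := by
      intro j hj
      rw [not_not.1 (mt (hsuppc j) hj), not_not.1 (mt (hsuppb j) hj), sub_zero]
    classical
    have hE' := linearIndepOn_iff''.1 hE
      (Finset.univ.filter fun j => |∑ a, X a j * ((y a - (X *ᵥ b) a) / lam)| = 1)
      (fun j => c j - b j) (by intro j hj; simpa using hj)
      (fun j hj => h0 j (by simpa using hj)) (by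
        rw [Finset.sum_subset (Finset.subset_univ _)
          (fun j _ hj => by rw [h0 j (by simpa using hj), zero_smul])]
        ext i
        have h := congrFun hfit i
        simp only [Matrix.mulVec, dotProduct] at h
        simp [mul_comm, mul_sub, Finset.sum_sub_distrib, h])
    ext j
    by_cases hj : |∑ a, X a j * ((y a - (X *ᵥ b) a) / lam)| = 1
    · exact sub_eq_zero.1 (hE' j (by simpa using hj))
    · exact sub_eq_zero.1 (h0 j hj)
  · exact hE.mono (t := {j | b j ≠ 0}) fun j hj => lasso_kkt X y lam hlam b hb j hj
end
end

section
/- Assume the n×p real matrix X satisfies the Generic Condition and fix y ∈ ℝⁿ. Then the map λ ↦ β̂_λ from (0,+∞) to ℝ^p, where β̂_λ is the unique LASSO minimizer, is bounded and continuous, and the map λ ↦ ‖β̂_λ‖₁ is non-increasing on (0,+∞). -/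
open MeasureTheory ProbabilityTheory Real Matrix
open scoped ENNReal

noncomputable section

lemma exists_least_squares {n p : ℕ} (X : Matrix (Fin n) (Fin p) ℝ) (y : Fin n → ℝ) :
    ∃ c : Fin p → ℝ, ∀ b : Fin p → ℝ,
      ∑ i, (y i - X.mulVec c i) ^ 2 ≤ ∑ i, (y i - X.mulVec b i) ^ 2 := by
  let f : (Fin p → ℝ) →ₗ[ℝ] EuclideanSpace ℝ (Fin n) :=
    (WithLp.linearEquiv 2 ℝ (Fin n → ℝ)).symm.toLinearMap ∘ₗ X.mulVecLin
  have hcl : IsClosed ((LinearMap.range f : Submodule ℝ (EuclideanSpace ℝ (Fin n))) :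
      Set (EuclideanSpace ℝ (Fin n))) := Submodule.closed_of_finiteDimensional _
  obtain ⟨z, ⟨c, rfl⟩, hz⟩ := hcl.exists_infDist_eq_dist ⟨0, Submodule.zero_mem _⟩ (WithLp.toLp 2 y)
  refine ⟨c, fun b => ?_⟩
  have h : dist (WithLp.toLp 2 y) (f c) ≤ dist (WithLp.toLp 2 y) (f b) := by
    rw [← hz]
    exact Metric.infDist_le_dist_of_mem ⟨b, rfl⟩
  have h2 := pow_le_pow_left₀ dist_nonneg h 2
  simpa [dist_eq_norm, EuclideanSpace.norm_sq_eq, f] using h2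

lemma lassoCost_continuous {n p : ℕ} (X : Matrix (Fin n) (Fin p) ℝ) (y : Fin n → ℝ) :
    Continuous fun q : ℝ × (Fin p → ℝ) => lassoCost X y q.1 q.2 := by
  unfold lassoCost Matrix.mulVec dotProduct
  fun_prop

/-- Under the Generic Condition, the map `λ ↦ β̂_λ` is bounded and
continuous on `(0, +∞)`, and `λ ↦ ‖β̂_λ‖₁` is non-increasing on `(0, +∞)`. -/
theorem lasso_path_bounded_continuous_l1_antitone
    {n p : ℕ} (X : Matrix (Fin n) (Fin p) ℝ) (hGC : GenericCondition X)
    (y : Fin n → ℝ) (bhat : ℝ → Fin p → ℝ)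
    (hmin : ∀ lam, 0 < lam → ∀ c, lassoCost X y lam (bhat lam) ≤ lassoCost X y lam c)
    (huniq : ∀ lam, 0 < lam → ∀ c,
      (∀ d, lassoCost X y lam c ≤ lassoCost X y lam d) → c = bhat lam) :
    (∃ M : ℝ, ∀ lam ∈ Set.Ioi (0 : ℝ), ∑ j, |bhat lam j| ≤ M) ∧
    ContinuousOn bhat (Set.Ioi 0) ∧
    AntitoneOn (fun lam => ∑ j, |bhat lam j|) (Set.Ioi 0) := by
  have hbd : ∃ M : ℝ, ∀ lam ∈ Set.Ioi (0 : ℝ), ∑ j, |bhat lam j| ≤ M := by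
    obtain ⟨c, hc⟩ := exists_least_squares X y
    refine ⟨∑ j, |c j|, fun lam hl => ?_⟩
    have hl : 0 < lam := hl
    have h1 := hmin lam hl c
    have h2 := hc (bhat lam)
    unfold lassoCost at h1
    refine le_of_mul_le_mul_left (a := lam) ?_ hl
    linarith
  refine ⟨hbd, ?_, ?_⟩
  · obtain ⟨M, hM⟩ := hbd
    intro l0 hl0
    have hl0 : 0 < l0 := hl0
    have hK : IsCompact (Metric.closedBall (0 : Fin p → ℝ) M) := isCompact_closedBall _ _
    refine hK.tendsto_nhds_of_unique_mapClusterPt ?_ ?_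
    · filter_upwards [self_mem_nhdsWithin] with lam hlam
      have h := hM lam hlam
      have h0 : 0 ≤ ∑ j, |bhat lam j| := Finset.sum_nonneg fun _ _ => abs_nonneg _
      rw [mem_closedBall_zero_iff, pi_norm_le_iff_of_nonneg (h0.trans h)]
      intro j
      rw [Real.norm_eq_abs]
      exact (Finset.single_le_sum (f := fun j => |bhat lam j|)
        (fun _ _ => abs_nonneg _) (Finset.mem_univ j)).trans h
    · intro x _ hx
      obtain ⟨U, hU, hUx⟩ := mapClusterPt_iff_ultrafilter.1 hx
      apply huniq l0 hl0
      intro d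
      have hid : Filter.Tendsto (fun l : ℝ => l) U (nhds l0) :=
        hU.trans nhdsWithin_le_nhds
      have t1 := ((lassoCost_continuous X y).tendsto (l0, x)).comp (hid.prodMk_nhds hUx)
      have t2 := ((lassoCost_continuous X y).tendsto (l0, d)).comp
        (hid.prodMk_nhds tendsto_const_nhds)
      refine le_of_tendsto_of_tendsto t1 t2 ?_
      have hev : ∀ᶠ l in (U : Filter ℝ), l ∈ Set.Ioi (0 : ℝ) := hU self_mem_nhdsWithin
      filter_upwards [hev] with l hl
      exact hmin l hl d
  · intro l hl m hm hlm
    have hl : 0 < l := hl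
    have hm : 0 < m := hm
    rcases hlm.eq_or_lt with rfl | hlt
    · exact le_rfl
    have h1 := hmin l hl (bhat m)
    have h2 := hmin m hm (bhat l)
    unfold lassoCost at h1 h2
    show ∑ j, |bhat m j| ≤ ∑ j, |bhat l j|
    refine le_of_mul_le_mul_left (a := m - l) ?_ (by linarith)
    linarith
end
end

section
/- Assume the n×p real matrix X satisfies the Generic Condition and fix y ∈ ℝⁿ. Define θ(λ) = inf_{b∈ℝ^p} (1/2)‖y − Xb‖₂² + λ‖b‖₁ for λ ∈ (0,+∞). Then θ is concave and non-decreasing on (0,+∞); moreover θ is differentiable on (0,+∞) with θ′(λ) = ‖β̂_λ‖₁, where β̂_λ is the unique LASSO minimizer at parameter λ. -/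
open MeasureTheory ProbabilityTheory Real Matrix
open scoped ENNReal

noncomputable section

/-- Under the Generic Condition, the value function
`θ(λ) = inf_b (1/2)‖y − Xb‖₂² + λ‖b‖₁` is concave and non-decreasing on `(0,+∞)`,
and differentiable there with `θ′(λ) = ‖β̂_λ‖₁`. -/
theorem lasso_value_function_concave_monotone_differentiable
    {n p : ℕ} (X : Matrix (Fin n) (Fin p) ℝ) (hGC : GenericCondition X)
    (y : Fin n → ℝ) (bhat : ℝ → Fin p → ℝ)
    (hmin : ∀ lam, 0 < lam → ∀ c, lassoCost X y lam (bhat lam) ≤ lassoCost X y lam c)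
    (huniq : ∀ lam, 0 < lam → ∀ c,
      (∀ d, lassoCost X y lam c ≤ lassoCost X y lam d) → c = bhat lam) :
    ConcaveOn ℝ (Set.Ioi 0) (fun lam => ⨅ b : Fin p → ℝ, lassoCost X y lam b) ∧
    MonotoneOn (fun lam => ⨅ b : Fin p → ℝ, lassoCost X y lam b) (Set.Ioi 0) ∧
    ∀ lam ∈ Set.Ioi (0 : ℝ),
      HasDerivAt (fun lam => ⨅ b : Fin p → ℝ, lassoCost X y lam b)
        (∑ j, |bhat lam j|) lam := by
  have hbdd : ∀ lam, 0 < lam → BddBelow (Set.range fun b : Fin p → ℝ => lassoCost X y lam b) := by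
    intro lam hl
    exact ⟨_, by rintro _ ⟨c, rfl⟩; exact hmin lam hl c⟩
  have hth : ∀ lam, 0 < lam → (⨅ b : Fin p → ℝ, lassoCost X y lam b) = lassoCost X y lam (bhat lam) := by
    intro lam hl
    exact le_antisymm (ciInf_le (hbdd lam hl) _) (le_ciInf (hmin lam hl))
  have hshift : ∀ lam mu b, lassoCost X y mu b = lassoCost X y lam b + (mu - lam) * ∑ j, |b j| := by
    intro lam mu b; unfold lassoCost; ring
  have hNnn : ∀ b : Fin p → ℝ, 0 ≤ ∑ j, |b j| := fun b => Finset.sum_nonneg fun j _ => abs_nonneg _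
  have hcont : Continuous fun q : ℝ × (Fin p → ℝ) => lassoCost X y q.1 q.2 := by
    unfold lassoCost Matrix.mulVec dotProduct
    fun_prop
  refine ⟨⟨convex_Ioi 0, ?_⟩, ?_, ?_⟩
  · intro s hs t ht a b ha hb hab
    have hs' : (0:ℝ) < s := hs
    have ht' : (0:ℝ) < t := ht
    have hm : 0 < a • s + b • t := (convex_Ioi (0:ℝ)) hs ht ha hb hab
    simp only [smul_eq_mul] at hm ⊢
    rw [hth _ hs', hth _ ht', hth _ hm]
    set c := bhat (a * s + b * t)
    have h1 := mul_le_mul_of_nonneg_left (hmin s hs' c) ha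
    have h2 := mul_le_mul_of_nonneg_left (hmin t ht' c) hb
    have h3 : lassoCost X y (a * s + b * t) c = a * lassoCost X y s c + b * lassoCost X y t c := by
      have : a = 1 - b := by linarith
      subst this
      unfold lassoCost; ring
    linarith
  · intro s hs t ht hst
    have hs' : (0:ℝ) < s := hs
    have ht' : (0:ℝ) < t := ht
    simp only
    rw [hth _ hs', hth _ ht', hshift s t]
    have := mul_nonneg (sub_nonneg.2 hst) (hNnn (bhat t))
    linarith [hmin s hs' (bhat t)]
  · intro lam hlam
    have hl : (0:ℝ) < lam := hlam
    have hev : ∀ᶠ mu in nhds lam, lam / 2 < mu := lt_mem_nhds (by linarith)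
    have htend : Filter.Tendsto bhat (nhds lam) (nhds (bhat lam)) := by
      set C := (1 / 2) * ∑ i, (y i) ^ 2 with hC
      have hmem : ∀ᶠ mu in nhds lam, bhat mu ∈ Metric.closedBall (0 : Fin p → ℝ) (C / (lam / 2)) := by
        filter_upwards [hev] with mu hmu
        have hmu0 : 0 < mu := by linarith
        have h0 := hmin mu hmu0 0
        have hN := hNnn (bhat mu)
        have hr : 0 ≤ ∑ i, (y i - X.mulVec (bhat mu) i) ^ 2 := Finset.sum_nonneg fun _ _ => sq_nonneg _
        have h1 : (lam / 2) * ∑ j, |bhat mu j| ≤ C := by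
          have h2 : mu * ∑ j, |bhat mu j| ≤ C := by
            simp [lassoCost] at h0
            rw [hC]
            linarith
          nlinarith
        have h3 : ∑ j, |bhat mu j| ≤ C / (lam / 2) := by
          rw [le_div_iff₀ (by linarith)]; linarith
        rw [mem_closedBall_zero_iff]
        refine (pi_norm_le_iff_of_nonneg (hN.trans h3)).2 fun j => ?_
        rw [Real.norm_eq_abs]
        exact (Finset.single_le_sum (f := fun j => |bhat mu j|) (fun j _ => abs_nonneg _)
          (Finset.mem_univ j)).trans h3
      refine (isCompact_closedBall _ _).tendsto_nhds_of_unique_mapClusterPt hmem ?_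
      intro c _ hc
      obtain ⟨U, hU, hUc⟩ := mapClusterPt_iff_ultrafilter.1 hc
      refine huniq lam hl c fun d => ?_
      have hid : Filter.Tendsto (fun mu : ℝ => mu) U (nhds lam) := hU
      have t1 := (hcont.tendsto (lam, c)).comp (hid.prodMk_nhds hUc)
      have t2 := (hcont.tendsto (lam, d)).comp (hid.prodMk_nhds (tendsto_const_nhds (x := d)))
      refine le_of_tendsto_of_tendsto t1 t2 ?_
      filter_upwards [hU hev] with mu hmu
      exact hmin mu (by linarith) d
    have hN : Filter.Tendsto (fun mu => ∑ j, |bhat mu j|) (nhds lam) (nhds (∑ j, |bhat lam j|)) := by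
      have hc : Continuous fun b : Fin p → ℝ => ∑ j, |b j| := by fun_prop
      exact (hc.tendsto _).comp htend
    rw [hasDerivAt_iff_isLittleO, Asymptotics.isLittleO_iff]
    intro ε hε
    filter_upwards [hev, Metric.tendsto_nhds.1 hN ε hε] with mu hmu hd
    have hmu0 : 0 < mu := by linarith
    rw [hth _ hmu0, hth _ hl, smul_eq_mul, Real.norm_eq_abs, Real.norm_eq_abs]
    rw [Real.dist_eq] at hd
    have h1 := hmin mu hmu0 (bhat lam)
    rw [hshift lam mu] at h1
    rw [hshift lam mu (bhat lam)] at h1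
    have h2 := hmin lam hl (bhat mu)
    rw [hshift lam mu (bhat mu)]
    set A := ∑ j, |bhat mu j|
    set B := ∑ j, |bhat lam j|
    have h3 : |(mu - lam) * (A - B)| ≤ ε * |mu - lam| := by
      rw [abs_mul, mul_comm]
      exact mul_le_mul_of_nonneg_right hd.le (abs_nonneg _)
    have h4 := (abs_le.1 h3).1
    have h5 := mul_nonneg hε.le (abs_nonneg (mu - lam))
    rw [abs_le]
    constructor <;> linarith
end
end

section
/- Let X be an n×p real matrix with unit ℓ²-norm columns and coherence μ(X) > 0, let H = X^t X − I_p, let 1 ≤ s ≤ p, and let δ₁,…,δ_p be i.i.d. Bernoulli random variables with success probability s/p; set R = diag(δ₁,…,δ_p). For a p×p matrix A let ‖A‖_{1→2} = max_{1≤j≤p} ‖A e_j‖₂ denote the operator norm from ℓ¹ to ℓ². Then for every v > 0 such that e·(s/p)·(‖X‖²/v²) ≤ 1, one has P( ‖R H‖_{1→2} ≥ v ) ≤ p·( e·(s/p)·‖X‖²/v² )^{ v²/μ(X)² }. -/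
open MeasureTheory ProbabilityTheory Real Matrix
open scoped ENNReal

noncomputable section

/-- The spectral (ℓ² operator) norm of a real matrix. -/
def spec {m k : Type*} [Fintype m] [Fintype k] [DecidableEq k] (A : Matrix m k ℝ) : ℝ :=
  ‖(Matrix.toEuclideanLin A).toContinuousLinearMap‖

/-- The coherence `μ(X) = max_{i ≠ j} |⟨X_i, X_j⟩|` of a matrix with columns `X_1, …, X_p`. -/
def coherence {n p : ℕ} (X : Matrix (Fin n) (Fin p) ℝ) : ℝ :=
  sSup {t : ℝ | ∃ i j : Fin p, i ≠ j ∧ t = |∑ k, X k i * X k j|}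

lemma chernoff_aux {p : ℕ} (a : Fin p → ℝ) (q m B V : ℝ) (hq : 0 < q) (hq1 : q ≤ 1)
    (hm : 0 < m) (hB : 0 < B) (hV : 0 < V) (ha : ∀ i, 0 ≤ a i) (ham : ∀ i, a i ≤ m)
    (hsum : ∑ i, a i ≤ B) (hc : Real.exp 1 * q * B / V ≤ 1) :
    ∑ b : Fin p → Bool with V ≤ ∑ i, (if b i then a i else 0),
      ∏ i, (if b i then q else 1 - q) ≤ (Real.exp 1 * q * B / V) ^ (V / m) := by
  set θ := Real.log (V / (q * B)) with hθ
  have hqB : 0 < q * B := mul_pos hq hB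
  have hexpθ : Real.exp θ = V / (q * B) := Real.exp_log (by positivity)
  have hlog : Real.log (Real.exp 1 * q * B / V) = 1 - θ := by
    have : Real.exp 1 * q * B / V = Real.exp 1 / (V / (q * B)) := by
      field_simp
    rw [this, Real.log_div (by positivity) (by positivity), Real.log_exp]
  have hθ1 : 1 ≤ θ := by
    have h := Real.log_nonpos (by positivity) hc
    rw [hlog] at h
    linarith
  have hθ0 : 0 ≤ θ := by linarith
  have hRHS : (Real.exp 1 * q * B / V) ^ (V / m) = Real.exp ((1 - θ) * (V / m)) := by
    rw [Real.rpow_def_of_pos (by positivity), hlog]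
  rw [hRHS]
  have hw : ∀ b : Fin p → Bool, 0 ≤ ∏ i, (if b i then q else 1 - q) := by
    intro b
    apply Finset.prod_nonneg
    intro i _
    split_ifs <;> linarith
  set g : Fin p → Bool → ℝ := fun i c =>
    (if c then q else 1 - q) * Real.exp (θ / m * (if c then a i else 0)) with hg
  calc ∑ b : Fin p → Bool with V ≤ ∑ i, (if b i then a i else 0),
        ∏ i, (if b i then q else 1 - q)
      ≤ ∑ b : Fin p → Bool with V ≤ ∑ i, (if b i then a i else 0),
        Real.exp (-(θ / m * V)) * ∏ i, g i (b i) := by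
        apply Finset.sum_le_sum
        intro b hb
        have hb' := (Finset.mem_filter.mp hb).2
        simp only [hg]
        rw [Finset.prod_mul_distrib, ← Real.exp_sum, ← Finset.mul_sum, mul_left_comm,
          ← Real.exp_add]
        apply le_mul_of_one_le_right (hw b)
        apply Real.one_le_exp
        have : θ / m * V ≤ θ / m * ∑ i, (if b i then a i else 0) :=
          mul_le_mul_of_nonneg_left hb' (by positivity)
        linarith
    _ ≤ ∑ b : Fin p → Bool, Real.exp (-(θ / m * V)) * ∏ i, g i (b i) := by
        apply Finset.sum_le_sum_of_subset_of_nonneg (Finset.filter_subset _ _)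
        intro b _ _
        apply mul_nonneg (Real.exp_pos _).le
        apply Finset.prod_nonneg
        intro i _
        apply mul_nonneg _ (Real.exp_pos _).le
        split_ifs <;> linarith
    _ = Real.exp (-(θ / m * V)) * ∏ i, (q * Real.exp (θ / m * a i) + (1 - q)) := by
        rw [← Finset.mul_sum]
        congr 1
        have := Finset.prod_univ_sum (fun _ : Fin p => (Finset.univ : Finset Bool)) g
        rw [Fintype.piFinset_univ] at this
        rw [← this]
        apply Finset.prod_congr rfl
        intro i _
        simp [hg]
    _ ≤ Real.exp (-(θ / m * V)) * ∏ i, Real.exp (q * (a i / m * (Real.exp θ - 1))) := by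
        apply mul_le_mul_of_nonneg_left _ (Real.exp_pos _).le
        apply Finset.prod_le_prod
        · intro i _
          have := Real.exp_pos (θ / m * a i)
          have := mul_pos hq this
          linarith
        · intro i _
          have h1 : Real.exp (θ / m * a i) ≤ a i / m * Real.exp θ + (1 - a i / m) := by
            have hle : a i / m ≤ 1 := (div_le_one hm).2 (ham i)
            have := convexOn_exp.2 (Set.mem_univ θ) (Set.mem_univ 0)
              (div_nonneg (ha i) hm.le) (sub_nonneg.2 hle) (by ring)
            simp only [smul_eq_mul, mul_zero, add_zero, Real.exp_zero, mul_one] at this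
            have e : θ / m * a i = a i / m * θ := by ring
            rw [e]
            exact this
          have h2 := Real.add_one_le_exp (q * (a i / m * (Real.exp θ - 1)))
          have h3 := mul_le_mul_of_nonneg_left h1 hq.le
          linarith
    _ ≤ Real.exp ((1 - θ) * (V / m)) := by
        rw [← Real.exp_sum, ← Real.exp_add]
        apply Real.exp_le_exp.2
        have e1 : ∑ i, q * (a i / m * (Real.exp θ - 1))
            = (∑ i, a i) * (q / m * (Real.exp θ - 1)) := by
          rw [Finset.sum_mul]
          apply Finset.sum_congr rfl
          intro i _
          ring
        have h0 : 0 ≤ Real.exp θ - 1 := by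
          have := Real.one_le_exp hθ0
          linarith
        have e2 : (∑ i, a i) * (q / m * (Real.exp θ - 1)) ≤ B * (q / m * (Real.exp θ - 1)) :=
          mul_le_mul_of_nonneg_right hsum (by positivity)
        have e3 : B * (q / m * (Real.exp θ - 1)) = V / m - q * B / m := by
          rw [hexpθ]
          field_simp
        have e4 : 0 ≤ q * B / m := by positivity
        have e5 : (1 - θ) * (V / m) = V / m - θ / m * V := by ring
        rw [e1, e5]
        linarith

lemma gram_col_le {n p : ℕ} (X : Matrix (Fin n) (Fin p) ℝ)
    (hcols : ∀ j, ∑ i, X i j ^ 2 = 1) (j : Fin p) :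
    ∑ i, ((Xᵀ * X) i j) ^ 2 ≤ spec X ^ 2 := by
  set w : Fin p → ℝ := fun i => (Xᵀ * X) i j with hw
  have hop := ((Matrix.toEuclideanLin X).toContinuousLinearMap).le_opNorm (WithLp.toLp 2 w)
  have hop2 : ∑ k, ((X *ᵥ w) k) ^ 2 ≤ spec X ^ 2 * ∑ i, w i ^ 2 := by
    have h2 := pow_le_pow_left₀ (norm_nonneg _) hop 2
    rw [mul_pow, EuclideanSpace.norm_sq_eq, EuclideanSpace.norm_sq_eq] at h2
    simpa [spec] using h2
  have hS : ∑ i, w i ^ 2 = ∑ k, X k j * (X *ᵥ w) k := by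
    have : ∀ i, w i ^ 2 = ∑ k, X k j * (X k i * w i) := by
      intro i
      rw [sq]
      nth_rewrite 1 [hw]
      simp only [Matrix.mul_apply, Matrix.transpose_apply]
      rw [Finset.sum_mul]
      apply Finset.sum_congr rfl
      intro k _
      ring
    simp_rw [this, Matrix.mulVec, dotProduct, Finset.mul_sum]
    exact Finset.sum_comm
  have hcs := Finset.sum_mul_sq_le_sq_mul_sq Finset.univ (fun k => X k j) (fun k => (X *ᵥ w) k)
  rw [← hS, hcols j, one_mul] at hcs
  have h0 : 0 ≤ ∑ i, w i ^ 2 := Finset.sum_nonneg fun i _ => sq_nonneg _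
  change ∑ i, w i ^ 2 ≤ _
  rcases h0.eq_or_lt with h | h
  · rw [← h]; positivity
  · have : (∑ i, w i ^ 2) * (∑ i, w i ^ 2) ≤ spec X ^ 2 * ∑ i, w i ^ 2 := by
      rw [← sq]; exact hcs.trans hop2
    exact le_of_mul_le_mul_right this h

lemma abs_le_coherence {n p : ℕ} (X : Matrix (Fin n) (Fin p) ℝ) (i j : Fin p) (h : i ≠ j) :
    |∑ k, X k i * X k j| ≤ coherence X := by
  apply le_csSup
  · apply Set.Finite.bddAbove
    apply (Set.finite_range (fun x : Fin p × Fin p => |∑ k, X k x.1 * X k x.2|)).subset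
    rintro t ⟨i, j, _, rfl⟩
    exact ⟨(i, j), rfl⟩
  · exact ⟨i, j, h, rfl⟩

/-- Tail bound for the `ℓ¹ → ℓ²` norm of `R H`, where `H = XᵀX − I` and
`R = diag(δ₁,…,δ_p)` with i.i.d. Bernoulli(s/p) entries:
`P(‖R H‖_{1→2} ≥ v) ≤ p (e (s/p) ‖X‖²/v²)^{v²/μ(X)²}` whenever `e (s/p) ‖X‖²/v² ≤ 1`. -/
theorem norm_one_two_tail_bound
    {n p : ℕ} (X : Matrix (Fin n) (Fin p) ℝ)
    (hcols : ∀ j, ∑ i, X i j ^ 2 = 1)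
    (hcoh : 0 < coherence X)
    (s : ℕ) (hs : 1 ≤ s) (hsp : s ≤ p)
    {Ω : Type*} [MeasurableSpace Ω] (μ : Measure Ω) [IsProbabilityMeasure μ]
    (d : Ω → Fin p → Bool)
    (hd : ∀ b : Fin p → Bool,
      μ {ω | d ω = b} =
        ∏ i, (if b i then (s : ℝ≥0∞) / p else 1 - (s : ℝ≥0∞) / p))
    (v : ℝ) (hv : 0 < v)
    (hcond : Real.exp 1 * ((s : ℝ) / p) * (spec X ^ 2 / v ^ 2) ≤ 1) :
    μ {ω | v ≤ ⨆ j : Fin p,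
        Real.sqrt (∑ i, ((Matrix.diagonal (fun k => if d ω k then (1 : ℝ) else 0) *
          (Xᵀ * X - 1) : Matrix (Fin p) (Fin p) ℝ) i j) ^ 2)} ≤
      ENNReal.ofReal ((p : ℝ) *
        (Real.exp 1 * ((s : ℝ) / p) * spec X ^ 2 / v ^ 2) ^ (v ^ 2 / coherence X ^ 2)) := by
  classical
  have hp : 0 < p := by omega
  have hpR : (0 : ℝ) < p := by exact_mod_cast hp
  have hsR : (0 : ℝ) < s := by exact_mod_cast hs
  have : Nonempty (Fin p) := ⟨⟨0, hp⟩⟩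
  set q : ℝ := (s : ℝ) / p with hqdef
  have hq : 0 < q := div_pos hsR hpR
  have hq1 : q ≤ 1 := (div_le_one hpR).2 (by exact_mod_cast hsp)
  have hqE : (s : ℝ≥0∞) / p = ENNReal.ofReal q := by
    rw [hqdef, ENNReal.ofReal_div_of_pos hpR, ENNReal.ofReal_natCast, ENNReal.ofReal_natCast]
  have hdiag : ∀ j, (Xᵀ * X) j j = 1 := by
    intro j
    rw [← hcols j]
    simp [Matrix.mul_apply, sq]
  set H : Matrix (Fin p) (Fin p) ℝ := Xᵀ * X - 1 with hH
  have hHjj : ∀ j, H j j = 0 := by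
    intro j
    simp [hH, Matrix.sub_apply, hdiag j]
  have hHij : ∀ i j, i ≠ j → H i j = (Xᵀ * X) i j := by
    intro i j h
    simp [hH, Matrix.sub_apply, Matrix.one_apply_ne h]
  have hB : 0 < spec X ^ 2 := by
    have j : Fin p := ⟨0, hp⟩
    have h1 := gram_col_le X hcols j
    have h2 := Finset.single_le_sum (f := fun i => ((Xᵀ * X) i j) ^ 2)
      (fun i _ => sq_nonneg _) (Finset.mem_univ j)
    simp only [hdiag j] at h2
    linarith
  have hsumH : ∀ j, ∑ i, H i j ^ 2 ≤ spec X ^ 2 := by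
    intro j
    refine le_trans (Finset.sum_le_sum ?_) (gram_col_le X hcols j)
    intro i _
    by_cases h : i = j
    · subst h
      rw [hHjj, zero_pow two_ne_zero]
      positivity
    · rw [hHij i j h]
  have hmH : ∀ i j, H i j ^ 2 ≤ coherence X ^ 2 := by
    intro i j
    by_cases h : i = j
    · subst h
      rw [hHjj, zero_pow two_ne_zero]
      positivity
    · rw [hHij i j h, ← sq_abs]
      apply pow_le_pow_left₀ (abs_nonneg _)
      simpa [Matrix.mul_apply] using abs_le_coherence X i j h
  set T : ℝ := (Real.exp 1 * q * spec X ^ 2 / v ^ 2) ^ (v ^ 2 / coherence X ^ 2) with hT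
  have hT0 : 0 ≤ T := by
    rw [hT]
    positivity
  have hcol : ∀ j, μ {ω | v ^ 2 ≤ ∑ i, (if d ω i then H i j ^ 2 else 0)} ≤ ENNReal.ofReal T := by
    intro j
    have hch := chernoff_aux (fun i => H i j ^ 2) q (coherence X ^ 2) (spec X ^ 2) (v ^ 2) hq hq1
      (by positivity) hB (by positivity) (fun i => sq_nonneg _) (fun i => hmH i j) (hsumH j)
      (by rw [mul_div_assoc]; exact hcond)
    refine le_trans ?_ (ENNReal.ofReal_le_ofReal hch)
    rw [ENNReal.ofReal_sum_of_nonneg]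
    · refine le_trans (measure_mono ?_) (le_trans (measure_biUnion_finset_le
        (Finset.univ.filter fun b : Fin p → Bool =>
          v ^ 2 ≤ ∑ i, (if b i then H i j ^ 2 else 0)) (fun b => {ω | d ω = b})) ?_)
      · intro ω hω
        simp only [Set.mem_iUnion, Finset.mem_filter, Finset.mem_univ, true_and]
        exact ⟨d ω, hω, rfl⟩
      · apply Finset.sum_le_sum
        intro b _
        rw [hd b, ENNReal.ofReal_prod_of_nonneg]
        · apply Finset.prod_le_prod'
          intro i _
          split_ifs
          · rw [hqE]
          · rw [hqE, ENNReal.ofReal_sub _ hq.le, ENNReal.ofReal_one]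
        · intro i _
          split_ifs <;> linarith
    · intro b _
      apply Finset.prod_nonneg
      intro i _
      split_ifs <;> linarith
  calc _ ≤ μ (⋃ j ∈ (Finset.univ : Finset (Fin p)),
        {ω | v ^ 2 ≤ ∑ i, (if d ω i then H i j ^ 2 else 0)}) := by
        apply measure_mono
        intro ω hω
        simp only [Set.mem_setOf_eq] at hω
        obtain ⟨j, hj⟩ := exists_eq_ciSup_of_finite (f := fun j : Fin p =>
          Real.sqrt (∑ i, ((Matrix.diagonal (fun k => if d ω k then (1 : ℝ) else 0) *
          H : Matrix (Fin p) (Fin p) ℝ) i j) ^ 2))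
        rw [← hj] at hω
        have h2 := (Real.le_sqrt' hv).1 hω
        simp only [Set.mem_iUnion, Finset.mem_univ, exists_true_left, Set.mem_setOf_eq]
        refine ⟨j, h2.trans (le_of_eq ?_)⟩
        apply Finset.sum_congr rfl
        intro i _
        rw [Matrix.diagonal_mul]
        split_ifs <;> simp
    _ ≤ ∑ j : Fin p, μ {ω | v ^ 2 ≤ ∑ i, (if d ω i then H i j ^ 2 else 0)} :=
        measure_biUnion_finset_le _ _
    _ ≤ ∑ _j : Fin p, ENNReal.ofReal T := Finset.sum_le_sum fun j _ => hcol j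
    _ = ENNReal.ofReal (p * T) := by
        rw [Finset.sum_const, Finset.card_univ, Fintype.card_fin, nsmul_eq_mul,
          ENNReal.ofReal_mul hpR.le, ENNReal.ofReal_natCast]
end
end

section
/- Let ν ≥ 1 be an integer and let Z₁,…,Z_ν be i.i.d. standard Gaussian random variables; write χ²(ν) = Z₁² + ⋯ + Z_ν². Then: (a) for every t ≥ 0, P( √(χ²(ν)) ≥ √ν + √(2t) ) ≤ e^{−t}; and (b) for every u > 0, P( χ²(ν) ≤ u·ν ) ≤ (2/√(πν))·(u·e/2)^{ν/4}. -/
open MeasureTheory ProbabilityTheory Real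
open scoped ENNReal

noncomputable section

lemma stirling_step (a : ℝ) (ha : 0 < a) : 1 ≤ (a + 1/2) * (log (a+1) - log a) := by
  have h := Real.le_log_one_add_of_nonneg (x := 1/a) (by positivity)
  have e : log (a+1) - log a = log (1 + 1/a) := by
    rw [← Real.log_div (by positivity) (by positivity)]; congr 1; field_simp
  rw [e]
  have : (a+1/2) * (2 * (1/a) / (1/a+2)) = 1 := by field_simp; ring
  nlinarith

def sf (a : ℝ) : ℝ := log (Gamma a) - (a - 1/2) * log a + a - log (2 * π) / 2

lemma sf_succ (a : ℝ) (ha : 0 < a) : sf (a+1) ≤ sf a := by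
  unfold sf
  rw [Real.Gamma_add_one ha.ne', Real.log_mul ha.ne' (Real.Gamma_pos_of_pos ha).ne']
  have := stirling_step a ha
  nlinarith

lemma sf_add_nat (a : ℝ) (ha : 0 < a) (n : ℕ) : sf (a + n) ≤ sf a := by
  induction n with
  | zero => simp
  | succ k ih =>
    refine le_trans ?_ ih
    have := sf_succ (a + k) (by positivity)
    push_cast
    rwa [← add_assoc]

lemma sf_nat (n : ℕ) (hn : 1 ≤ n) : 0 ≤ sf n := by
  have hn0 : (0:ℝ) < n := by exact_mod_cast hn
  have h := Stirling.le_factorial_stirling n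
  have h2 := Real.log_le_log (by positivity) h
  rw [← Real.Gamma_nat_eq_factorial, Real.Gamma_add_one hn0.ne',
    Real.log_mul hn0.ne' (Real.Gamma_pos_of_pos hn0).ne', Real.log_mul (by positivity) (by positivity),
    Real.log_sqrt (by positivity), Real.log_mul (by positivity) (by positivity), Real.log_pow,
    Real.log_div (by positivity) (by positivity), Real.log_exp] at h2
  unfold sf
  nlinarith

lemma sf_half (n : ℕ) (hn : 2 ≤ n) : 1/2 * log ((n - 1) / (n + 1/2)) ≤ sf (n + 1/2) := by
  have hn0 : (2:ℝ) ≤ n := by exact_mod_cast hn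
  have h0 := sf_nat n (by omega)
  have hc := Real.convexOn_log_Gamma.2 (show (n:ℝ) - 1 ∈ Set.Ioi (0:ℝ) by simp; linarith)
    (show (n:ℝ) + 1/2 ∈ Set.Ioi (0:ℝ) by simp; linarith) (show (0:ℝ) ≤ 1/3 by norm_num) (show (0:ℝ) ≤ 2/3 by norm_num) (by norm_num)
  have e : (1/3 : ℝ) • ((n:ℝ) - 1) + (2/3 : ℝ) • ((n:ℝ) + 1/2) = n := by
    simp only [smul_eq_mul]; ring
  rw [e] at hc
  simp only [Function.comp, smul_eq_mul] at hc
  have e2 : log (Gamma n) = log (n - 1) + log (Gamma (n - 1)) := by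
    have := Real.Gamma_add_one (s := (n:ℝ) - 1) (by linarith)
    rw [sub_add_cancel] at this
    rw [this, Real.log_mul (by linarith) (Real.Gamma_pos_of_pos (by linarith)).ne']
  have e3 : log ((n:ℝ) + 1/2) ≤ log n + 1 / (2 * n) := by
    have : (n:ℝ) + 1/2 = n * (1 + 1/(2*n)) := by field_simp
    rw [this, Real.log_mul (by positivity) (by positivity)]
    have := Real.log_le_sub_one_of_pos (x := 1 + 1/(2*(n:ℝ))) (by positivity)
    linarith
  rw [Real.log_div (by linarith) (by linarith)]
  unfold sf at *
  have e4 : (n - 1/2 : ℝ) * log ((n:ℝ) + 1/2) ≤ (n - 1/2) * (log n + 1 / (2 * n)) :=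
    mul_le_mul_of_nonneg_left e3 (by linarith)
  have e5 : (n - 1/2 : ℝ) * (1 / (2 * n)) ≤ 1/2 := by
    field_simp; linarith
  nlinarith

lemma sf_half_nonneg (k : ℕ) : 0 ≤ sf (k + 1/2) := by
  have hle : ∀ n : ℕ, 2 ≤ n → k ≤ n → 1/2 * log ((n - 1) / (n + 1/2)) ≤ sf (k + 1/2) := by
    intro n hn hk
    refine (sf_half n hn).trans ?_
    obtain ⟨m, rfl⟩ := Nat.exists_eq_add_of_le hk
    have := sf_add_nat (k + 1/2) (by positivity) m
    have e : ((k + m : ℕ) : ℝ) + 1/2 = k + 1/2 + m := by push_cast; ring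
    rwa [e]
  have ht : Filter.Tendsto (fun n : ℕ => 1/2 * log (((n:ℝ) - 1) / (n + 1/2))) Filter.atTop (nhds 0) := by
    have h1 : Filter.Tendsto (fun n : ℕ => ((n:ℝ) + (-1)) / (n + 1/2)) Filter.atTop (nhds 1) := by
      have a1 := tendsto_natCast_div_add_atTop (𝕜 := ℝ) (1/2)
      have a2 : Filter.Tendsto (fun n : ℕ => (1:ℝ) / (n + 1/2)) Filter.atTop (nhds 0) := by
        apply Filter.Tendsto.div_atTop tendsto_const_nhds
        exact Filter.tendsto_atTop_add_const_right _ _ tendsto_natCast_atTop_atTop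
      have := a1.sub a2
      rw [sub_zero] at this
      refine this.congr fun n => ?_
      ring
    have h2 := (h1.log one_ne_zero).const_mul (1/2)
    simpa [sub_eq_add_neg] using h2
  refine le_of_tendsto ht ?_
  filter_upwards [Filter.eventually_ge_atTop 2, Filter.eventually_ge_atTop k] with n h1 h2
  exact hle n h1 h2

lemma gamma_lower (ν : ℕ) (hν : 1 ≤ ν) : 0 ≤ sf ((ν:ℝ)/2) := by
  obtain ⟨k, hk | hk⟩ := Nat.even_or_odd' ν
  · have := sf_nat k (by omega)
    rw [hk]; convert this using 2; push_cast; ring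
  · have := sf_half_nonneg k
    rw [hk]; convert this using 2; push_cast; ring

lemma gauss_int (s : ℝ) (hs : s < 1/2) :
    ∫ x, exp (s * x ^ 2) ∂(gaussianReal 0 1) = (√(1 - 2 * s))⁻¹ := by
  rw [integral_gaussianReal_eq_integral_smul one_ne_zero]
  have : ∀ x : ℝ, gaussianPDFReal 0 1 x • exp (s * x ^ 2) = (√(2 * π))⁻¹ * exp (-(1/2 - s) * x ^ 2) := by
    intro x
    simp only [gaussianPDFReal, smul_eq_mul, NNReal.coe_one, mul_one, sub_zero]
    rw [mul_assoc, ← Real.exp_add]; congr 2; ring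
  simp_rw [this]
  rw [integral_const_mul, integral_gaussian, ← Real.sqrt_inv, ← Real.sqrt_inv, ← Real.sqrt_mul (by positivity)]
  congr 1
  have : 1 - 2 * s ≠ 0 := by linarith
  have h2 : 1/2 - s ≠ 0 := by linarith
  field_simp

lemma upper_tail (ν : ℕ) (hν : 1 ≤ ν) (t : ℝ) (ht : 0 ≤ t) :
    (Measure.pi fun _ : Fin ν => gaussianReal 0 1)
      {x | √(ν : ℝ) + √(2 * t) ≤ √(∑ i, x i ^ 2)} ≤ ENNReal.ofReal (exp (-t)) := by
  set G := (Measure.pi fun _ : Fin ν => gaussianReal 0 1) with hG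
  have hn : (0:ℝ) < ν := by exact_mod_cast hν
  set r := √(ν : ℝ) + √(2 * t) with hr
  have hsn : 0 < √(ν:ℝ) := by positivity
  have hrn : √(ν:ℝ) ≤ r := by have := Real.sqrt_nonneg (2*t); linarith
  have hr0 : 0 < r := by linarith
  have hr2 : (ν:ℝ) ≤ r ^ 2 := by
    calc (ν:ℝ) = √(ν:ℝ)^2 := (Real.sq_sqrt hn.le).symm
      _ ≤ _ := by gcongr
  set s := (1 - ν / r ^ 2) / 2 with hs
  have hs12 : 1 - 2 * s = ν / r ^ 2 := by rw [hs]; ring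
  have hs0 : 0 ≤ s := by
    have : ν / r ^ 2 ≤ 1 := (div_le_one (by positivity)).2 hr2
    linarith
  have hslt : s < 1/2 := by
    have : 0 < ν / r^2 := by positivity
    linarith
  have hmg : ∫ x, exp (s * ∑ i, x i ^ 2) ∂G = ((√(ν / r ^ 2))⁻¹) ^ ν := by
    have := integral_fintype_prod_eq_pow (ι := Fin ν) (fun x : ℝ => exp (s * x^2)) (μ := gaussianReal 0 1)
    rw [gauss_int s hslt, hs12, Fintype.card_fin] at this
    rw [← this]
    congr 1; ext x
    rw [Finset.mul_sum, Real.exp_sum]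
  have hmg2 : (√(ν / r ^ 2))⁻¹ = r / √ν := by
    rw [Real.sqrt_div hn.le, Real.sqrt_sq hr0.le, inv_div]
  have hint : Integrable (fun x : Fin ν → ℝ => exp (s * ∑ i, x i ^ 2)) G := by
    by_contra h
    have := integral_undef h
    rw [hmg, hmg2] at this
    have : 0 < (r / √ν)^ν := by positivity
    linarith
  have hch := measure_ge_le_exp_mul_mgf (μ := G) (X := fun x => ∑ i, x i ^ 2) (r ^ 2) hs0 hint
  rw [mgf, hmg, hmg2] at hch
  have hset : {x : Fin ν → ℝ | r ≤ √(∑ i, x i ^ 2)} = {x | r ^ 2 ≤ ∑ i, x i ^ 2} := by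
    ext x
    simp only [Set.mem_ofPred_eq]
    exact Real.le_sqrt' hr0
  rw [hset]
  have hfin : exp (-s * r ^ 2) * (r / √ν) ^ ν ≤ exp (-t) := by
    have e1 : s * r ^ 2 = (r ^ 2 - ν) / 2 := by rw [hs]; field_simp
    have e2 : (r / √ν) ^ ν = exp (ν * log (r / √ν)) := by
      rw [mul_comm, Real.exp_mul, Real.exp_log (by positivity), Real.rpow_natCast]
    rw [e2, ← Real.exp_add, Real.exp_le_exp]
    have hl := Real.log_le_sub_one_of_pos (x := r / √ν) (by positivity)
    have e3 : r / √ν - 1 = √(2*t) / √ν := by rw [hr]; field_simp; ring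
    rw [e3] at hl
    have hl2 := mul_le_mul_of_nonneg_left hl hn.le
    have e4 : (ν:ℝ) * (√(2*t) / √ν) = √ν * √(2*t) := by
      nth_rewrite 1 [← Real.mul_self_sqrt hn.le]; field_simp
    have e5 : r ^ 2 = ν + 2 * (√ν * √(2*t)) + 2 * t := by
      rw [hr, add_sq, Real.sq_sqrt hn.le, Real.sq_sqrt (by positivity)]; ring
    nlinarith
  rw [← ENNReal.ofReal_toReal (measure_ne_top G _)]
  exact ENNReal.ofReal_le_ofReal (hch.trans hfin)

lemma pi_gauss_density (n : ℕ) :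
    (Measure.pi fun _ : Fin n => gaussianReal 0 1) =
      (volume : Measure (Fin n → ℝ)).withDensity
        (fun x => ENNReal.ofReal (∏ i, gaussianPDFReal 0 1 (x i))) := by
  refine Measure.pi_eq fun s hs => ?_
  rw [withDensity_apply _ (MeasurableSet.univ_pi hs), volume_pi, Measure.restrict_pi_pi,
    ← ofReal_integral_eq_lintegral_ofReal]
  · rw [integral_fintype_prod_eq_prod (fun _ => gaussianPDFReal 0 1), ENNReal.ofReal_prod_of_nonneg]
    · refine Finset.prod_congr rfl fun i _ => ?_
      rw [gaussianReal_apply_eq_integral _ one_ne_zero]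
    · intro i _
      exact integral_nonneg fun x => gaussianPDFReal_nonneg _ _ _
  · exact Integrable.fintype_prod (f := fun _ => gaussianPDFReal 0 1)
      fun i => (integrable_gaussianPDFReal _ _).restrict
  · exact Filter.Eventually.of_forall fun x => Finset.prod_nonneg fun i _ => gaussianPDFReal_nonneg _ _ _

lemma ball_integral (n : ℕ) (hn : 1 ≤ n) (C R : ℝ) (hR : 0 < R) :
    Integrable (fun x : EuclideanSpace ℝ (Fin n) => 
      (Set.Iic R).indicator (fun y => C * y ^ (-((n:ℝ)/2))) ‖x‖) ∧
    ∫ x : EuclideanSpace ℝ (Fin n), (Set.Iic R).indicator (fun y => C * y ^ (-((n:ℝ)/2))) ‖x‖ =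
      2 * (√π ^ n / Gamma (n/2+1)) * C * R ^ ((n:ℝ)/2) := by
  have hn0 : (0:ℝ) < n := by exact_mod_cast hn
  have : Nonempty (Fin n) := ⟨⟨0, hn⟩⟩
  have key : Set.EqOn (fun y : ℝ => y ^ (n - 1) • (Set.Iic R).indicator (fun y => C * y ^ (-((n:ℝ)/2))) y)
      ((Set.Iic R).indicator (fun y => C * y ^ ((n:ℝ)/2 - 1))) (Set.Ioi 0) := by
    intro y hy
    have hy : 0 < y := hy
    by_cases h : y ≤ R
    · simp only [Set.indicator, Set.mem_Iic, h, if_true, smul_eq_mul]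
      rw [← Real.rpow_natCast, mul_left_comm, ← Real.rpow_add hy, Nat.cast_sub hn]
      congr 2; push_cast; ring
    · simp [Set.indicator, h]
  have hii : IntervalIntegrable (fun y : ℝ => C * y ^ ((n:ℝ)/2 - 1)) volume 0 R :=
    (intervalIntegral.intervalIntegrable_rpow' (by linarith)).const_mul C
  constructor
  · rw [integrable_fun_norm_addHaar volume (f := (Set.Iic R).indicator (fun y => C * y ^ (-((n:ℝ)/2))))]
    rw [finrank_euclideanSpace_fin, integrableOn_congr_fun key measurableSet_Ioi,
      integrableOn_indicator_iff measurableSet_Iic, Set.inter_comm, Set.Ioi_inter_Iic]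
    exact (intervalIntegrable_iff_integrableOn_Ioc_of_le hR.le).1 hii
  · rw [integral_fun_norm_addHaar volume ((Set.Iic R).indicator (fun y => C * y ^ (-((n:ℝ)/2))))]
    rw [finrank_euclideanSpace_fin, setIntegral_congr_fun measurableSet_Ioi key,
      setIntegral_indicator measurableSet_Iic, Set.Ioi_inter_Iic, ← intervalIntegral.integral_of_le hR.le,
      intervalIntegral.integral_const_mul, integral_rpow (Or.inl (by linarith)), Measure.real,
      EuclideanSpace.volume_ball]
    rw [Fintype.card_fin, sub_add_cancel, Real.zero_rpow (by positivity)]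
    have : 0 < Gamma ((n:ℝ)/2+1) := Real.Gamma_pos_of_pos (by positivity)
    rw [ENNReal.ofReal_one, one_pow, one_mul, ENNReal.toReal_ofReal (by positivity)]
    simp only [nsmul_eq_mul, smul_eq_mul]
    field_simp
    ring

lemma lower_tail_aux (n : ℕ) (hn : 1 ≤ n) (R : ℝ) (hR : 0 < R) :
    (Measure.pi fun _ : Fin n => gaussianReal 0 1) {x | ∑ i, x i ^ 2 ≤ R ^ 2} ≤
      ENNReal.ofReal (2 * (√π ^ n / Gamma (n/2+1)) *
        ((√(2*π))⁻¹ ^ n * exp ((n:ℝ)/4 * (log (n/2) - 1))) * R ^ ((n:ℝ)/2)) := by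
  have hn0 : (0:ℝ) < n := by exact_mod_cast hn
  have : Nonempty (Fin n) := ⟨⟨0, hn⟩⟩
  set C := ((√(2*π))⁻¹ ^ n * exp ((n:ℝ)/4 * (log (n/2) - 1))) with hC
  have hC0 : 0 ≤ C := by positivity
  obtain ⟨h1, h2⟩ := ball_integral n hn C R hR
  set F : ℝ → ℝ := (Set.Iic R).indicator (fun y => C * y ^ (-((n:ℝ)/2))) with hF
  have hF0 : ∀ x : EuclideanSpace ℝ (Fin n), 0 ≤ F ‖x‖ := by
    intro x
    rw [hF]
    unfold Set.indicator
    split_ifs <;> positivity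
  rw [← h2, ofReal_integral_eq_lintegral_ofReal h1 (Filter.Eventually.of_forall hF0)]
  have hS : MeasurableSet {x : Fin n → ℝ | ∑ i, x i ^ 2 ≤ R ^ 2} :=
    measurableSet_le (by fun_prop) (by fun_prop)
  rw [pi_gauss_density, withDensity_apply _ hS, ← lintegral_indicator hS]
  have hmp := PiLp.volume_preserving_toLp (Fin n)
  have hemb : MeasurableEmbedding (@WithLp.toLp 2 (Fin n → ℝ)) :=
    (MeasurableEquiv.toLp 2 (Fin n → ℝ)).measurableEmbedding
  rw [← hmp.lintegral_comp_emb hemb]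
  refine lintegral_mono_ae ?_
  have hne : ∀ᵐ x : Fin n → ℝ, x ≠ 0 := by
    rw [ae_iff]; simp
  filter_upwards [hne] with x hx
  by_cases hxS : x ∈ {x : Fin n → ℝ | ∑ i, x i ^ 2 ≤ R ^ 2}
  swap
  · simp [Set.indicator_of_notMem hxS]
  rw [Set.indicator_of_mem hxS]
  apply ENNReal.ofReal_le_ofReal
  set r := ‖WithLp.toLp 2 x‖ with hr
  have hr2 : r ^ 2 = ∑ i, x i ^ 2 := by
    rw [hr, EuclideanSpace.real_norm_sq_eq]
  have hr0 : 0 < r := by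
    rw [hr, norm_pos_iff]
    simpa using hx
  have hrR : r ≤ R := by
    have : r ^ 2 ≤ R ^ 2 := by rw [hr2]; exact hxS
    exact (pow_le_pow_iff_left₀ hr0.le hR.le two_ne_zero).1 this
  rw [hF, Set.indicator_of_mem (show r ∈ Set.Iic R from hrR)]
  simp only [gaussianPDFReal, NNReal.coe_one, mul_one, sub_zero]
  rw [Finset.prod_mul_distrib, Finset.prod_const, Finset.card_univ, Fintype.card_fin, ← Real.exp_sum,
    hC, mul_assoc]
  refine mul_le_mul_of_nonneg_left ?_ (by positivity)
  rw [← Finset.sum_div, Finset.sum_neg_distrib, ← hr2, Real.rpow_def_of_pos hr0, ← Real.exp_add,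
    Real.exp_le_exp]
  have hl := Real.log_le_sub_one_of_pos (x := r^2 / (n/2)) (by positivity)
  rw [Real.log_div (by positivity) (by positivity), Real.log_pow] at hl
  have hl2 := mul_le_mul_of_nonneg_left hl (show 0 ≤ (n:ℝ)/4 by positivity)
  have : (n:ℝ)/4 * (r^2/(n/2) - 1) = r^2/2 - n/4 := by field_simp; ring
  rw [this] at hl2
  push_cast at hl2
  linarith

lemma lower_tail (n : ℕ) (hn : 1 ≤ n) (u : ℝ) (hu : 0 < u) :
    (Measure.pi fun _ : Fin n => gaussianReal 0 1) {x | ∑ i, x i ^ 2 ≤ u * n} ≤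
      ENNReal.ofReal ((2 / √(π * n)) * (u * exp 1 / 2) ^ ((n : ℝ) / 4)) := by
  have hn0 : (0:ℝ) < n := by exact_mod_cast hn
  have h := lower_tail_aux n hn (√(u * n)) (by positivity)
  rw [Real.sq_sqrt (by positivity)] at h
  refine h.trans (ENNReal.ofReal_le_ofReal ?_)
  have hs := gamma_lower n hn
  have hG : 0 < Gamma ((n:ℝ)/2) := Real.Gamma_pos_of_pos (by positivity)
  rw [Real.Gamma_add_one (by positivity)]
  rw [← Real.log_le_log_iff (by positivity) (by positivity)]
  unfold sf at hs
  rw [Real.log_mul (by positivity) (by positivity), Real.log_mul (by positivity) (by positivity),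
    Real.log_mul (by positivity) (by positivity), Real.log_div (by positivity) (by positivity),
    Real.log_mul (by positivity) hG.ne', Real.log_mul (by positivity) (by positivity),
    Real.log_pow, Real.log_pow, Real.log_exp, Real.log_inv, Real.log_rpow (by positivity),
    Real.log_sqrt (by positivity), Real.log_sqrt (by positivity), Real.log_sqrt (by positivity),
    Real.log_mul hu.ne' hn0.ne', Real.log_mul two_ne_zero pi_ne_zero,
    Real.log_mul (by positivity) (by positivity), Real.log_div (by positivity) (by positivity),
    Real.log_rpow (by positivity), Real.log_div (by positivity) (by positivity),
    Real.log_div (y := 2) (by positivity) (by positivity), Real.log_mul hu.ne' (by positivity), Real.log_exp, Real.log_sqrt (by positivity),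
    Real.log_mul pi_ne_zero hn0.ne']
  rw [Real.log_div (by positivity) (by positivity), Real.log_mul two_ne_zero pi_ne_zero] at hs
  nlinarith


/-- Tail bounds for the chi-square distribution: if `Z₁,…,Z_ν` are
i.i.d. standard Gaussians and `χ²(ν) = Z₁² + ⋯ + Z_ν²`, then
(a) `P(√(χ²(ν)) ≥ √ν + √(2t)) ≤ e^{−t}` for all `t ≥ 0`, and
(b) `P(χ²(ν) ≤ uν) ≤ (2/√(πν)) (ue/2)^{ν/4}` for all `u > 0`. -/
theorem chi_square_tail_bounds
    (ν : ℕ) (hν : 1 ≤ ν)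
    {Ω : Type*} [MeasurableSpace Ω] (μ : Measure Ω) [IsProbabilityMeasure μ]
    (Z : Fin ν → Ω → ℝ)
    (hmeas : Measurable fun ω => fun i => Z i ω)
    (hlaw : Measure.map (fun ω => fun i => Z i ω) μ =
      Measure.pi fun _ : Fin ν => gaussianReal 0 1) :
    (∀ t : ℝ, 0 ≤ t →
      μ {ω | Real.sqrt (ν : ℝ) + Real.sqrt (2 * t) ≤ Real.sqrt (∑ i, Z i ω ^ 2)} ≤
        ENNReal.ofReal (Real.exp (-t))) ∧
    (∀ u : ℝ, 0 < u →
      μ {ω | ∑ i, Z i ω ^ 2 ≤ u * ν} ≤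
        ENNReal.ofReal ((2 / Real.sqrt (Real.pi * ν)) *
          (u * Real.exp 1 / 2) ^ ((ν : ℝ) / 4))) := by
  have hset : ∀ S : Set (Fin ν → ℝ), MeasurableSet S →
      μ {ω | (fun i => Z i ω) ∈ S} = (Measure.pi fun _ : Fin ν => gaussianReal 0 1) S := by
    intro S hS
    rw [← hlaw, Measure.map_apply hmeas hS]
    rfl
  refine ⟨fun t ht => ?_, fun u hu => ?_⟩
  · refine le_trans (le_of_eq ?_) (upper_tail ν hν t ht)
    exact hset {x | √(ν : ℝ) + √(2 * t) ≤ √(∑ i, x i ^ 2)}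
      (measurableSet_le (by fun_prop) (by fun_prop))
  · refine le_trans (le_of_eq ?_) (lower_tail ν hν u hu)
    exact hset {x | ∑ i, x i ^ 2 ≤ u * ν} (measurableSet_le (by fun_prop) (by fun_prop))
end
end

section
/- Let ν ≥ 1 be an integer and let Z₁,…,Z_ν be i.i.d. standard Gaussian random variables; write χ²(ν) = Z₁² + ⋯ + Z_ν². Then for every real a with 0 < a < ν/2 and every u > 0, P( χ²(ν) ≤ u·ν ) ≤ ( (a/e)^a / ((ν/2 − a)·Γ(ν/2)) ) · ( u·ν/2 )^{ν/2 − a}, where Γ is the Gamma function. -/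
open MeasureTheory ProbabilityTheory Real
open scoped ENNReal

noncomputable section

/-- The standard Gaussian product measure has the product density. -/
lemma pi_gaussian_eq (ν : ℕ) :
    (Measure.pi fun _ : Fin ν => gaussianReal 0 1) =
      (volume : Measure (Fin ν → ℝ)).withDensity
        (fun x => ENNReal.ofReal (∏ i, gaussianPDFReal 0 1 (x i))) := by
  apply Measure.pi_eq
  intro s hs
  rw [withDensity_apply _ (MeasurableSet.univ_pi hs), volume_pi, Measure.restrict_pi_pi,
    ← ofReal_integral_eq_lintegral_ofReal]
  · rw [integral_fintype_prod_eq_prod (fun _ => gaussianPDFReal 0 1),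
      ENNReal.ofReal_prod_of_nonneg]
    · refine Finset.prod_congr rfl fun i _ => ?_
      rw [gaussianReal_apply_eq_integral _ one_ne_zero]
    · intro i _
      exact integral_nonneg (gaussianPDFReal_nonneg 0 1)
  · exact Integrable.fintype_prod (f := fun _ => gaussianPDFReal 0 1)
      fun i => (integrable_gaussianPDFReal 0 1).restrict
  · exact Filter.Eventually.of_forall fun x =>
      Finset.prod_nonneg fun i _ => gaussianPDFReal_nonneg 0 1 _

/-- Pointwise bound `exp (-x) ≤ (a/e)^a x^(-a)`. -/
lemma exp_neg_le_rpow (a x : ℝ) (ha : 0 < a) (hx : 0 < x) :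
    Real.exp (-x) ≤ (a / Real.exp 1) ^ a * x ^ (-a) := by
  have h1 : Real.log (x / a) ≤ x / a - 1 := Real.log_le_sub_one_of_pos (by positivity)
  rw [Real.log_div hx.ne' ha.ne'] at h1
  rw [Real.rpow_def_of_pos (by positivity), Real.rpow_def_of_pos hx, ← Real.exp_add,
    Real.log_div ha.ne' (Real.exp_pos 1).ne', Real.log_exp]
  apply Real.exp_le_exp.mpr
  have h2 := mul_le_mul_of_nonneg_left h1 ha.le
  have h3 : a * (x / a - 1) = x - a := by field_simp
  rw [h3] at h2
  nlinarith

lemma prod_pdf (ν : ℕ) (x : Fin ν → ℝ) :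
    ∏ i, gaussianPDFReal 0 1 (x i) = (√(2 * π))⁻¹ ^ ν * Real.exp (-((∑ i, x i ^ 2) / 2)) := by
  simp only [gaussianPDFReal, NNReal.coe_one, mul_one, sub_zero]
  rw [Finset.prod_mul_distrib, ← Real.exp_sum]
  simp [Finset.sum_div, neg_div]

/-- The radial integral. -/
lemma radial_integral (ν : ℕ) (hν : 1 ≤ ν) (a R : ℝ) (hR : 0 < R) (ha' : a < (ν : ℝ) / 2) :
    IntegrableOn (fun y : ℝ => y ^ (ν - 1) • (Set.Iic R).indicator (fun r => r ^ (-2 * a)) y)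
      (Set.Ioi 0) ∧
    ∫ y in Set.Ioi (0 : ℝ), y ^ (ν - 1) • (Set.Iic R).indicator (fun r => r ^ (-2 * a)) y =
      R ^ ((ν : ℝ) - 2 * a) / ((ν : ℝ) - 2 * a) := by
  have h0 : ∀ y ∈ Set.Ioi (0 : ℝ),
      (Set.Iic R).indicator (fun r => r ^ ((ν : ℝ) - 1 - 2 * a)) y =
      y ^ (ν - 1) • (Set.Iic R).indicator (fun r => r ^ (-2 * a)) y := by
    intro y hy
    have hy : 0 < y := hy
    by_cases h : y ∈ Set.Iic R
    · simp only [Set.indicator_of_mem h, smul_eq_mul]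
      rw [← Real.rpow_natCast, ← Real.rpow_add hy, Nat.cast_sub hν]
      congr 1
      push_cast
      ring
    · simp [Set.indicator_of_notMem h]
  have hI : IntervalIntegrable (fun r : ℝ => r ^ ((ν : ℝ) - 1 - 2 * a)) volume 0 R :=
    intervalIntegral.intervalIntegrable_rpow' (by linarith)
  constructor
  · refine IntegrableOn.congr_fun ?_ h0 measurableSet_Ioi
    rw [intervalIntegrable_iff_integrableOn_Ioc_of_le hR.le] at hI
    rw [IntegrableOn, integrable_indicator_iff measurableSet_Iic, IntegrableOn,
      Measure.restrict_restrict measurableSet_Iic, Set.Iic_inter_Ioi]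
    exact hI
  · rw [← setIntegral_congr_fun measurableSet_Ioi h0, integral_indicator measurableSet_Iic,
      Measure.restrict_restrict measurableSet_Iic, Set.Iic_inter_Ioi,
      ← intervalIntegral.integral_of_le hR.le, integral_rpow (Or.inl (by linarith))]
    rw [Real.zero_rpow (by linarith)]
    ring_nf

lemma const_eq (ν : ℕ) (hν : 1 ≤ ν) (a u K : ℝ) (ha' : a < (ν : ℝ) / 2) (hu : 0 < u) :
    (√(2 * π))⁻¹ ^ ν * (K * 2 ^ a) * (ν * ((√π ^ ν / Real.Gamma ((ν : ℝ) / 2 + 1)) *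
      (√(u * ν) ^ ((ν : ℝ) - 2 * a) / ((ν : ℝ) - 2 * a)))) =
    (K / (((ν : ℝ) / 2 - a) * Real.Gamma ((ν : ℝ) / 2))) * (u * ν / 2) ^ ((ν : ℝ) / 2 - a) := by
  have hν0 : (0 : ℝ) < ν := by exact_mod_cast hν
  have hG : 0 < Real.Gamma ((ν : ℝ) / 2) := Real.Gamma_pos_of_pos (by positivity)
  rw [Real.Gamma_add_one (by positivity)]
  have e1 : √(u * ν) ^ ((ν : ℝ) - 2 * a) = (u * ν) ^ ((ν : ℝ) / 2 - a) := by
    rw [Real.sqrt_eq_rpow, ← Real.rpow_mul (by positivity)]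
    congr 1
    ring
  have e2 : (√(2 * π))⁻¹ ^ ν * √π ^ ν = (2 : ℝ) ^ (-((ν : ℝ) / 2)) := by
    rw [← mul_pow, Real.sqrt_mul (by norm_num)]
    have : (√2 * √π)⁻¹ * √π = (2 : ℝ) ^ (-(1 / 2 : ℝ)) := by
      rw [Real.rpow_neg (by norm_num), ← Real.sqrt_eq_rpow]
      have := Real.sqrt_pos.mpr Real.pi_pos
      field_simp
    rw [this, ← Real.rpow_natCast, ← Real.rpow_mul (by norm_num)]
    congr 1
    ring
  have e3 : (2 : ℝ) ^ (-((ν : ℝ) / 2)) * 2 ^ a = ((2 : ℝ) ^ ((ν : ℝ) / 2 - a))⁻¹ := by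
    rw [← Real.rpow_add (by norm_num), ← Real.rpow_neg (by norm_num)]
    congr 1
    ring
  rw [e1, Real.div_rpow (by positivity) (by norm_num), div_eq_mul_inv _ ((2 : ℝ) ^ _), ← e3, ← e2]
  have h4 : (ν : ℝ) / 2 - a ≠ 0 := by linarith
  have h5 : (ν : ℝ) - 2 * a = 2 * ((ν : ℝ) / 2 - a) := by ring
  rw [h5]
  generalize (ν : ℝ) / 2 - a = b at *
  field_simp

/-- Lower tail bound for the chi-square distribution with a free
parameter `a`: if `Z₁,…,Z_ν` are i.i.d. standard Gaussians and `χ²(ν) = Z₁² + ⋯ + Z_ν²`,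
then for every `0 < a < ν/2` and every `u > 0`,
`P(χ²(ν) ≤ uν) ≤ ((a/e)^a / ((ν/2 − a) Γ(ν/2))) (uν/2)^{ν/2 − a}`. -/
theorem chi_square_lower_tail_parametrized
    (ν : ℕ) (hν : 1 ≤ ν)
    {Ω : Type*} [MeasurableSpace Ω] (μ : Measure Ω) [IsProbabilityMeasure μ]
    (Z : Fin ν → Ω → ℝ)
    (hmeas : Measurable fun ω => fun i => Z i ω)
    (hlaw : Measure.map (fun ω => fun i => Z i ω) μ =
      Measure.pi fun _ : Fin ν => gaussianReal 0 1)
    (a : ℝ) (ha : 0 < a) (ha' : a < (ν : ℝ) / 2)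
    (u : ℝ) (hu : 0 < u) :
    μ {ω | ∑ i, Z i ω ^ 2 ≤ u * ν} ≤
      ENNReal.ofReal (((a / Real.exp 1) ^ a / (((ν : ℝ) / 2 - a) * Real.Gamma ((ν : ℝ) / 2))) *
        (u * ν / 2) ^ ((ν : ℝ) / 2 - a)) := by
  have hν0 : (0 : ℝ) < ν := by exact_mod_cast hν
  have : Nonempty (Fin ν) := ⟨⟨0, hν⟩⟩
  set R : ℝ := √(u * ν) with hRdef
  have hR : 0 < R := Real.sqrt_pos.mpr (by positivity)
  set S : Set (Fin ν → ℝ) := {x | ∑ i, x i ^ 2 ≤ u * ν} with hS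
  have hSm : MeasurableSet S := measurableSet_le (by fun_prop) (by fun_prop)
  have h1 : μ {ω | ∑ i, Z i ω ^ 2 ≤ u * ν} = (Measure.pi fun _ : Fin ν => gaussianReal 0 1) S := by
    rw [← hlaw, Measure.map_apply hmeas hSm]
    rfl
  set f : ℝ → ℝ := (Set.Iic R).indicator (fun r => r ^ (-2 * a)) with hf
  set C : ℝ := (√(2 * π))⁻¹ ^ ν * ((a / Real.exp 1) ^ a * 2 ^ a) with hC
  have hC0 : 0 ≤ C := by positivity
  obtain ⟨hint, hval⟩ := radial_integral ν hν a R hR ha'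
  have hintE : Integrable (fun x : EuclideanSpace ℝ (Fin ν) => f ‖x‖) := by
    rw [integrable_fun_norm_addHaar volume (f := f)]
    rw [finrank_euclideanSpace_fin]
    exact hint
  have hbound : ∀ x : Fin ν → ℝ, x ≠ 0 →
      S.indicator (fun x => ENNReal.ofReal (∏ i, gaussianPDFReal 0 1 (x i))) x ≤
        ENNReal.ofReal (C * f ‖WithLp.toLp 2 x‖) := by
    intro x hx
    by_cases hxS : x ∈ S
    swap
    · simp [Set.indicator_of_notMem hxS]
    rw [Set.indicator_of_mem hxS]
    apply ENNReal.ofReal_le_ofReal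
    have hn : ‖WithLp.toLp 2 x‖ ^ 2 = ∑ i, x i ^ 2 := by
      rw [EuclideanSpace.norm_sq_eq]
      simp
    have hpos : 0 < ‖WithLp.toLp 2 x‖ := by
      rw [norm_pos_iff]
      simpa using hx
    have hle : ‖WithLp.toLp 2 x‖ ≤ R := by
      apply Real.le_sqrt_of_sq_le
      rw [hn]
      exact hxS
    rw [hf, Set.indicator_of_mem (Set.mem_Iic.mpr hle), prod_pdf, ← hn]
    generalize ‖WithLp.toLp 2 x‖ = r at *
    have h2 := exp_neg_le_rpow a (r ^ 2 / 2) ha (by positivity)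
    have h3 : (r ^ 2 / 2) ^ (-a) = 2 ^ a * r ^ (-2 * a) := by
      rw [Real.div_rpow (by positivity) (by norm_num), Real.rpow_neg (by norm_num : (0:ℝ) ≤ 2),
        ← Real.rpow_natCast r 2, ← Real.rpow_mul hpos.le, div_inv_eq_mul, mul_comm]
      congr 2
      push_cast
      ring
    rw [h3] at h2
    calc _ ≤ (√(2 * π))⁻¹ ^ ν * ((a / Real.exp 1) ^ a * (2 ^ a * r ^ (-2 * a))) := by gcongr
      _ = _ := by rw [hC]; ring
  have hf0 : ∀ x : EuclideanSpace ℝ (Fin ν), 0 ≤ C * f ‖x‖ := by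
    intro x
    refine mul_nonneg hC0 ?_
    rw [hf]
    by_cases h : ‖x‖ ∈ Set.Iic R
    · rw [Set.indicator_of_mem h]
      positivity
    · rw [Set.indicator_of_notMem h]
  rw [h1, pi_gaussian_eq, withDensity_apply _ hSm, ← lintegral_indicator hSm]
  have hae : ∀ᵐ x : Fin ν → ℝ, x ≠ 0 := by
    rw [ae_iff]
    simp
  calc _ ≤ ∫⁻ x : Fin ν → ℝ, ENNReal.ofReal (C * f ‖WithLp.toLp 2 x‖) :=
        lintegral_mono_ae (hae.mono hbound)
    _ = ∫⁻ x : EuclideanSpace ℝ (Fin ν), ENNReal.ofReal (C * f ‖x‖) :=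
        (PiLp.volume_preserving_toLp (Fin ν)).lintegral_comp_emb
          (MeasurableEquiv.toLp 2 (Fin ν → ℝ)).measurableEmbedding
          (fun x => ENNReal.ofReal (C * f ‖x‖))
    _ = ENNReal.ofReal (∫ x : EuclideanSpace ℝ (Fin ν), C * f ‖x‖) :=
        (ofReal_integral_eq_lintegral_ofReal (hintE.const_mul C)
          (Filter.Eventually.of_forall hf0)).symm
    _ = _ := by
        congr 1
        rw [integral_const_mul, integral_fun_norm_addHaar volume f]
        have hball : (volume : Measure (EuclideanSpace ℝ (Fin ν))).real (Metric.ball 0 1) =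
            √π ^ ν / Real.Gamma ((ν : ℝ) / 2 + 1) := by
          rw [Measure.real, EuclideanSpace.volume_ball]
          have : 0 < Real.Gamma ((ν : ℝ) / 2 + 1) := Real.Gamma_pos_of_pos (by positivity)
          simp only [Fintype.card_fin, ENNReal.ofReal_one, one_pow, one_mul]
          exact ENNReal.toReal_ofReal (by positivity)
        rw [hball, finrank_euclideanSpace_fin, hval, nsmul_eq_mul, smul_eq_mul]
        exact const_eq ν hν a u _ ha' hu
end
end

section
/- Let X be an n×p real matrix, let T ⊆ {1,…,p} with X_T of full column rank s, let β ∈ ℝ^p be supported on T with sign vector ε = sgn(β_T) ∈ {−1,1}^s, let z ∈ ℝⁿ, and set y = Xβ + z. For λ > 0 define β̃_T(λ) = (X_T^t X_T)^{−1}(X_T^t y − λ·ε). Let K > 0 satisfy K > ‖X_T(X_T^t X_T)^{−1}ε‖₂². Then λ > 0 satisfies λ² = (1/K)·‖y − X_T·β̃_T(λ)‖₂² if and only if λ² = ‖P_{V_T^⊥} z‖₂² / ( K − ‖X_T(X_T^t X_T)^{−1}ε‖₂² ), where P_{V_T^⊥} is the orthogonal projection of ℝⁿ onto the orthogonal complement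 of the range of X_T. (Taking K = n/(C_var·log p), this is the implicit equation defining the oracle relaxation parameter of Strategy (A).) -/
open MeasureTheory ProbabilityTheory Real Matrix
open scoped ENNReal

noncomputable section

/-- With `y = Xβ + z`, `β` supported on `T` (with `X_T` of full column
rank), `ε = sgn(β_T)`, and the oracle `β̃_T(λ) = (X_TᵀX_T)⁻¹(X_Tᵀ y − λ ε)`:
for `K > ‖X_T (X_TᵀX_T)⁻¹ ε‖₂²`, a parameter `λ > 0` satisfies
`λ² = (1/K) ‖y − X_T β̃_T(λ)‖₂²` iff
`λ² = ‖P_{V_T^⊥} z‖₂² / (K − ‖X_T (X_TᵀX_T)⁻¹ ε‖₂²)`. -/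
theorem oracle_lambda_strategyA_characterization
    {n p : ℕ} (X : Matrix (Fin n) (Fin p) ℝ) (T : Finset (Fin p))
    (hrank : LinearIndependent ℝ (fun j : {x // x ∈ T} => fun i => X i j.val))
    (β : Fin p → ℝ) (hsupp : ∀ j, β j ≠ 0 ↔ j ∈ T)
    (ε : {x // x ∈ T} → ℝ) (hε : ∀ j, ε j = Real.sign (β j.val))
    (z y : Fin n → ℝ) (hy : y = fun i => X.mulVec β i + z i)
    (K : ℝ)
    (hK : (∑ i, ((colSub X T *ᵥ (((colSub X T)ᵀ * colSub X T)⁻¹ *ᵥ ε)) i) ^ 2) < K)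
    -- `Pz` is the orthogonal projection of `z` onto the orthogonal complement of the
    -- range `V_T` of `X_T`:
    (Pz : Fin n → ℝ)
    (hPz_orth : ∀ c : {x // x ∈ T} → ℝ, ∑ i, Pz i * (colSub X T *ᵥ c) i = 0)
    (hPz_range : ∃ c : {x // x ∈ T} → ℝ, (fun i => z i - Pz i) = colSub X T *ᵥ c)
    (lam : ℝ) (hlam : 0 < lam) :
    (lam ^ 2 = (1 / K) *
        ∑ i, (y i - (colSub X T *ᵥ
          (((colSub X T)ᵀ * colSub X T)⁻¹ *ᵥ ((colSub X T)ᵀ *ᵥ y - lam • ε))) i) ^ 2)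
    ↔ lam ^ 2 = (∑ i, Pz i ^ 2) /
        (K - ∑ i, ((colSub X T *ᵥ (((colSub X T)ᵀ * colSub X T)⁻¹ *ᵥ ε)) i) ^ 2) := by
  obtain ⟨c, hc⟩ := hPz_range
  set A := colSub X T with hA
  have hinj : Function.Injective A.mulVec := by
    rw [Matrix.mulVec_injective_iff]
    exact hrank
  have hpd : (Aᵀ * A).PosDef := by
    have h := Matrix.PosDef.conjTranspose_mul_self A hinj
    rwa [Matrix.conjTranspose_eq_transpose_of_trivial] at h
  have hdet : IsUnit (Aᵀ * A).det := isUnit_iff_ne_zero.mpr hpd.det_pos.ne'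
  have hXβ : X *ᵥ β = A *ᵥ (fun j => β j.val) := by
    funext i
    simp only [Matrix.mulVec, dotProduct, hA, colSub, Matrix.of_apply]
    rw [Finset.sum_coe_sort T (fun j => X i j * β j)]
    symm
    apply Finset.sum_subset (Finset.subset_univ T)
    intro j _ hj
    have : β j = 0 := by
      by_contra h
      exact hj ((hsupp j).1 h)
    simp [this]
  have hPz0 : Aᵀ *ᵥ Pz = 0 := by
    funext j
    have h := hPz_orth (Pi.single j 1)
    simp only [Matrix.mulVec_single_one, Matrix.col_apply] at h
    simp only [Matrix.mulVec, dotProduct, Matrix.transpose_apply, Pi.zero_apply]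
    rw [← h]
    exact Finset.sum_congr rfl fun i _ => mul_comm _ _
  have hy2 : y = A *ᵥ ((fun j => β j.val) + c) + Pz := by
    rw [Matrix.mulVec_add, ← hXβ, ← hc, hy]
    funext i
    simp only [Pi.add_apply]
    ring
  have hGy : (Aᵀ * A)⁻¹ *ᵥ (Aᵀ *ᵥ y - lam • ε)
      = ((fun j => β j.val) + c) - lam • ((Aᵀ * A)⁻¹ *ᵥ ε) := by
    rw [hy2, Matrix.mulVec_add Aᵀ, hPz0, add_zero, Matrix.mulVec_sub, Matrix.mulVec_mulVec,
      Matrix.mulVec_mulVec, Matrix.mul_assoc, Matrix.nonsing_inv_mul _ hdet, Matrix.one_mulVec, Matrix.mulVec_smul]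
  have hres : ∀ i, y i - (A *ᵥ ((Aᵀ * A)⁻¹ *ᵥ (Aᵀ *ᵥ y - lam • ε))) i
      = Pz i + lam * (A *ᵥ ((Aᵀ * A)⁻¹ *ᵥ ε)) i := by
    intro i
    rw [hGy, Matrix.mulVec_sub, Matrix.mulVec_smul, congrFun hy2 i]
    simp only [Pi.add_apply, Pi.sub_apply, Pi.smul_apply, smul_eq_mul]
    ring
  simp only [hres]
  have horth := hPz_orth ((Aᵀ * A)⁻¹ *ᵥ ε)
  set w := A *ᵥ ((Aᵀ * A)⁻¹ *ᵥ ε) with hw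
  have hsum : ∑ i, (Pz i + lam * w i) ^ 2 = ∑ i, Pz i ^ 2 + lam ^ 2 * ∑ i, w i ^ 2 := by
    have : ∀ i, (Pz i + lam * w i) ^ 2
        = Pz i ^ 2 + 2 * lam * (Pz i * w i) + lam ^ 2 * w i ^ 2 := fun i => by ring
    simp only [this, Finset.sum_add_distrib, ← Finset.mul_sum, horth]
    ring
  have hS : 0 ≤ ∑ i, w i ^ 2 := Finset.sum_nonneg fun i _ => sq_nonneg _
  have hK0 : 0 < K := lt_of_le_of_lt hS hK
  rw [hsum, eq_div_iff (sub_pos.mpr hK).ne', one_div, eq_inv_mul_iff_mul_eq₀ hK0.ne']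
  constructor <;> intro h <;> linarith
end
end

section
/- Let X be an n×p real matrix, let b ∈ ℝ^p have support T with X_T of full column rank, let λ ∈ ℝ, and let y ∈ ℝⁿ satisfy X_T^t (y − X b) = λ·sgn(b_T). Then b_T = (X_T^t X_T)^{−1}( X_T^t y − λ·sgn(b_T) ), and ‖y − X b‖₂² = ‖P_{V_T^⊥} y‖₂² + λ²·sgn(b_T)^t (X_T^t X_T)^{−1} sgn(b_T), where P_{V_T^⊥} is the orthogonal projection of ℝⁿ onto the orthogonal complement of the range of X_T. -/
open MeasureTheory ProbabilityTheory Real Matrix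
open scoped ENNReal

noncomputable section

/-- If `b` has support `T` with `X_T` of full column rank and
`X_Tᵀ (y − Xb) = λ sgn(b_T)`, then `b_T = (X_TᵀX_T)⁻¹(X_Tᵀ y − λ sgn(b_T))` and
`‖y − Xb‖₂² = ‖P_{V_T^⊥} y‖₂² + λ² sgn(b_T)ᵀ (X_TᵀX_T)⁻¹ sgn(b_T)`. -/
theorem lasso_stationarity_identities
    {n p : ℕ} (X : Matrix (Fin n) (Fin p) ℝ) (b : Fin p → ℝ) (T : Finset (Fin p))
    (hsupp : ∀ j, b j ≠ 0 ↔ j ∈ T)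
    (hrank : LinearIndependent ℝ (fun j : {x // x ∈ T} => fun i => X i j.val))
    (lam : ℝ) (y : Fin n → ℝ)
    (hstat : ∀ j : {x // x ∈ T},
      ((colSub X T)ᵀ *ᵥ fun i => y i - X.mulVec b i) j = lam * Real.sign (b j.val))
    -- `Py` is the orthogonal projection of `y` onto the orthogonal complement of the
    -- range `V_T` of `X_T`:
    (Py : Fin n → ℝ)
    (hPy_orth : ∀ c : {x // x ∈ T} → ℝ, ∑ i, Py i * (colSub X T *ᵥ c) i = 0)
    (hPy_range : ∃ c : {x // x ∈ T} → ℝ, (fun i => y i - Py i) = colSub X T *ᵥ c) :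
    (∀ j : {x // x ∈ T},
      b j.val = (((colSub X T)ᵀ * colSub X T)⁻¹ *ᵥ
        ((colSub X T)ᵀ *ᵥ y - lam • fun i : {x // x ∈ T} => Real.sign (b i.val))) j) ∧
    ∑ i, (y i - X.mulVec b i) ^ 2 =
      (∑ i, Py i ^ 2) + lam ^ 2 *
        ∑ j : {x // x ∈ T}, Real.sign (b j.val) *
          ((((colSub X T)ᵀ * colSub X T)⁻¹ *ᵥ fun i : {x // x ∈ T} => Real.sign (b i.val)) j) := by
  obtain ⟨c, hc⟩ := hPy_range
  set A := colSub X T with hA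
  set s : {x // x ∈ T} → ℝ := fun i => Real.sign (b i.val) with hs
  set bT : {x // x ∈ T} → ℝ := fun j => b j.val with hbT
  have hXb : X.mulVec b = A *ᵥ bT := by
    ext i
    simp only [Matrix.mulVec, dotProduct, hA, colSub, hbT, Matrix.of_apply]
    rw [← Finset.sum_subset (Finset.subset_univ T)]
    · exact (Finset.sum_coe_sort T (fun j => X i j * b j)).symm
    · intro j _ hj
      have : b j = 0 := by
        by_contra h
        exact hj ((hsupp j).1 h)
      simp [this]
  have hAinj : Function.Injective A.mulVec := by
    rw [Matrix.mulVec_injective_iff]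
    exact hrank
  have hGu : IsUnit (Aᵀ * A) := by
    rw [← Matrix.mulVec_injective_iff_isUnit]
    intro v w hvw
    apply hAinj
    have h0 : (Aᵀ * A) *ᵥ (v - w) = 0 := by
      rw [Matrix.mulVec_sub]
      exact sub_eq_zero.2 hvw
    have h1 : (A *ᵥ (v - w)) ⬝ᵥ (A *ᵥ (v - w)) = 0 := by
      rw [Matrix.dotProduct_mulVec, ← Matrix.mulVec_transpose, Matrix.mulVec_mulVec, h0,
        zero_dotProduct]
    have h2 := dotProduct_self_eq_zero.1 h1
    rw [Matrix.mulVec_sub] at h2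
    exact sub_eq_zero.1 h2
  have hdet : IsUnit (Aᵀ * A).det := (Matrix.isUnit_iff_isUnit_det _).1 hGu
  have hsolve : ∀ u v, (Aᵀ * A) *ᵥ u = v → u = (Aᵀ * A)⁻¹ *ᵥ v := by
    intro u v h
    rw [← h, Matrix.mulVec_mulVec, Matrix.nonsing_inv_mul _ hdet, Matrix.one_mulVec]
  have hst : Aᵀ *ᵥ (y - A *ᵥ bT) = lam • s := by
    ext j
    have := hstat j
    rw [hXb] at this
    exact this
  have horth : Aᵀ *ᵥ Py = 0 := by
    apply dotProduct_self_eq_zero.1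
    have := hPy_orth (Aᵀ *ᵥ Py)
    change Py ⬝ᵥ (A *ᵥ (Aᵀ *ᵥ Py)) = 0 at this
    rwa [Matrix.dotProduct_mulVec, ← Matrix.mulVec_transpose] at this
  have hr : y - A *ᵥ bT = Py + A *ᵥ (c - bT) := by
    have hc' : y - Py = A *ᵥ c := hc
    rw [Matrix.mulVec_sub, ← hc']
    abel
  have hGd : (Aᵀ * A) *ᵥ (c - bT) = lam • s := by
    rw [← hst, hr, Matrix.mulVec_add, horth, zero_add, Matrix.mulVec_mulVec]
  constructor
  · intro j
    refine congrFun (hsolve bT _ ?_) j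
    rw [← hst, Matrix.mulVec_sub, Matrix.mulVec_mulVec]
    abel
  · have hd := hsolve _ _ hGd
    have hPA : Py ⬝ᵥ (A *ᵥ (c - bT)) = 0 := hPy_orth _
    have key : (y - A *ᵥ bT) ⬝ᵥ (y - A *ᵥ bT)
        = Py ⬝ᵥ Py + lam ^ 2 * (s ⬝ᵥ ((Aᵀ * A)⁻¹ *ᵥ s)) := by
      rw [hr, add_dotProduct, dotProduct_add, dotProduct_add, hPA,
        dotProduct_comm (A *ᵥ (c - bT)) Py, hPA, Matrix.dotProduct_mulVec (A *ᵥ (c - bT)),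
        ← Matrix.mulVec_transpose, Matrix.mulVec_mulVec, hGd, hd, Matrix.mulVec_smul,
        smul_dotProduct, dotProduct_smul, smul_eq_mul, smul_eq_mul]
      ring
    rw [hXb]
    simp only [pow_two (_ - _), pow_two (Py _)]
    exact key
end
end

section
/- Let X be an n×p real matrix, let T ⊆ {1,…,p} with X_T of full column rank s, let β ∈ ℝ^p be supported on T with sign vector ε = sgn(β_T), let z ∈ ℝⁿ, and set y = Xβ + z. For λ > 0 define β̃_T(λ) = (X_T^t X_T)^{−1}(X_T^t y − λ·ε), and let C > 0. Then λ > 0 satisfies the trade-off equation (1/2)·‖y − X_T·β̃_T(λ)‖₂² = C·λ·ε^t β̃_T(λ) if and only if λ is a root of the quadratic equation (1/2 + C)·λ²·(ε^t (X_T^t X_T)^{−1} ε) − C·λ·(ε^t (X_T^t X_T)^{−1} X_T^t y) + (1/2)·‖P_{V_T^⊥} z‖₂² = 0, where P_{V_T^⊥} is the orthogonal projection of ℝⁿ onto the orthogonal complement of the range of X_T. -/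
open MeasureTheory ProbabilityTheory Real Matrix
open scoped ENNReal

noncomputable section

theorem quad_aux {n : ℕ} {ι : Type*} [Fintype ι] [DecidableEq ι] (A : Matrix (Fin n) ι ℝ)
    (hA : LinearIndependent ℝ A.col) (ε d : ι → ℝ) (y Pz : Fin n → ℝ) (C lam : ℝ)
    (hy : y = A *ᵥ d + Pz) (hP : ∀ c : ι → ℝ, Pz ⬝ᵥ (A *ᵥ c) = 0) :
    ((1 / 2) * ∑ i, (y i - (A *ᵥ ((Aᵀ * A)⁻¹ *ᵥ (Aᵀ *ᵥ y - lam • ε))) i) ^ 2 =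
      C * lam * ∑ j, ε j * (((Aᵀ * A)⁻¹ *ᵥ (Aᵀ *ᵥ y - lam • ε)) j))
    ↔ (1 / 2 + C) * lam ^ 2 * (∑ j, ε j * (((Aᵀ * A)⁻¹ *ᵥ ε) j)) -
        C * lam * (∑ j, ε j * (((Aᵀ * A)⁻¹ *ᵥ (Aᵀ *ᵥ y)) j)) +
        (1 / 2) * ∑ i, Pz i ^ 2 = 0 := by
  have hinj : Function.Injective A.mulVec := Matrix.mulVec_injective_iff.mpr hA
  have hpd : (Aᵀ * A).PosDef := by
    have := Matrix.PosDef.conjTranspose_mul_self A hinj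
    rwa [Matrix.conjTranspose_eq_transpose_of_trivial] at this
  have hu : IsUnit (Aᵀ * A).det := (Matrix.isUnit_iff_isUnit_det _).mp hpd.isUnit
  have hPA : Aᵀ *ᵥ Pz = 0 := by
    apply dotProduct_eq_zero
    intro c
    rw [Matrix.mulVec_transpose, ← Matrix.dotProduct_mulVec]
    exact hP c
  have hd : (Aᵀ * A)⁻¹ *ᵥ (Aᵀ *ᵥ y) = d := by
    rw [hy, Matrix.mulVec_add, hPA, add_zero, Matrix.mulVec_mulVec, Matrix.mulVec_mulVec,
      Matrix.mul_assoc, Matrix.nonsing_inv_mul _ hu, Matrix.one_mulVec]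
  obtain ⟨w, hw⟩ : ∃ w, w = (Aᵀ * A)⁻¹ *ᵥ ε := ⟨_, rfl⟩
  have hGw : (Aᵀ * A) *ᵥ w = ε := by
    rw [hw, Matrix.mulVec_mulVec, Matrix.mul_nonsing_inv _ hu, Matrix.one_mulVec]
  rw [Matrix.mulVec_sub, Matrix.mulVec_smul, hd, ← hw]
  have hww : (A *ᵥ w) ⬝ᵥ (A *ᵥ w) = ε ⬝ᵥ w := by
    rw [Matrix.dotProduct_mulVec, ← Matrix.mulVec_transpose, Matrix.mulVec_mulVec, hGw]
  have h1 : ∑ i, (y i - (A *ᵥ (d - lam • w)) i) ^ 2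
      = ∑ i, Pz i ^ 2 + lam ^ 2 * (ε ⬝ᵥ w) := by
    have h2 : ∀ i, (y i - (A *ᵥ (d - lam • w)) i) ^ 2
        = Pz i ^ 2 + 2 * lam * (Pz i * (A *ᵥ w) i) + lam ^ 2 * ((A *ᵥ w) i * (A *ᵥ w) i) := by
      intro i
      rw [hy, Matrix.mulVec_sub, Matrix.mulVec_smul]
      simp only [Pi.add_apply, Pi.sub_apply, Pi.smul_apply, smul_eq_mul]
      ring
    have h3 : ∑ i, Pz i * (A *ᵥ w) i = 0 := hP w
    have h4 : ∑ i, (A *ᵥ w) i * (A *ᵥ w) i = ε ⬝ᵥ w := hww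
    simp only [h2, Finset.sum_add_distrib, ← Finset.mul_sum, h3, h4]
    ring
  have h5 : ∑ j, ε j * (d - lam • w) j = ε ⬝ᵥ d - lam * (ε ⬝ᵥ w) := by
    change ε ⬝ᵥ (d - lam • w) = _
    rw [dotProduct_sub, dotProduct_smul, smul_eq_mul]
  have h6 : ∑ j, ε j * w j = ε ⬝ᵥ w := rfl
  have h7 : ∑ j, ε j * d j = ε ⬝ᵥ d := rfl
  rw [h1, h5, h6, h7]
  constructor <;> intro h <;> linarith

/-- With `y = Xβ + z`, `β` supported on `T` (with `X_T` of full column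
rank), `ε = sgn(β_T)`, and the oracle `β̃_T(λ) = (X_TᵀX_T)⁻¹(X_Tᵀ y − λ ε)`:
a parameter `λ > 0` satisfies the trade-off equation
`(1/2) ‖y − X_T β̃_T(λ)‖₂² = C λ εᵀ β̃_T(λ)` iff it is a root of the quadratic
`(1/2 + C) λ² εᵀ(X_TᵀX_T)⁻¹ε − C λ εᵀ(X_TᵀX_T)⁻¹X_Tᵀ y + (1/2)‖P_{V_T^⊥} z‖₂² = 0`. -/
theorem oracle_lambda_strategyB_quadratic
    {n p : ℕ} (X : Matrix (Fin n) (Fin p) ℝ) (T : Finset (Fin p))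
    (hrank : LinearIndependent ℝ (fun j : {x // x ∈ T} => fun i => X i j.val))
    (β : Fin p → ℝ) (hsupp : ∀ j, β j ≠ 0 ↔ j ∈ T)
    (ε : {x // x ∈ T} → ℝ) (hε : ∀ j, ε j = Real.sign (β j.val))
    (z y : Fin n → ℝ) (hy : y = fun i => X.mulVec β i + z i)
    (C : ℝ) (hC : 0 < C)
    -- `Pz` is the orthogonal projection of `z` onto the orthogonal complement of the
    -- range `V_T` of `X_T`:
    (Pz : Fin n → ℝ)
    (hPz_orth : ∀ c : {x // x ∈ T} → ℝ, ∑ i, Pz i * (colSub X T *ᵥ c) i = 0)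
    (hPz_range : ∃ c : {x // x ∈ T} → ℝ, (fun i => z i - Pz i) = colSub X T *ᵥ c)
    (lam : ℝ) (hlam : 0 < lam) :
    ((1 / 2) * ∑ i, (y i - (colSub X T *ᵥ
        (((colSub X T)ᵀ * colSub X T)⁻¹ *ᵥ ((colSub X T)ᵀ *ᵥ y - lam • ε))) i) ^ 2 =
      C * lam * ∑ j, ε j *
        ((((colSub X T)ᵀ * colSub X T)⁻¹ *ᵥ ((colSub X T)ᵀ *ᵥ y - lam • ε)) j))
    ↔ (1 / 2 + C) * lam ^ 2 *
          (∑ j, ε j * ((((colSub X T)ᵀ * colSub X T)⁻¹ *ᵥ ε) j)) -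
        C * lam *
          (∑ j, ε j * ((((colSub X T)ᵀ * colSub X T)⁻¹ *ᵥ ((colSub X T)ᵀ *ᵥ y)) j)) +
        (1 / 2) * ∑ i, Pz i ^ 2 = 0 := by
  obtain ⟨c, hc⟩ := hPz_range
  refine quad_aux (colSub X T) hrank ε ((fun j => β j.val) + c) y Pz C lam ?_ hPz_orth
  rw [Matrix.mulVec_add, ← hc, hy]
  funext i
  have hb : (X *ᵥ β) i = (colSub X T *ᵥ fun j => β j.val) i := by
    simp only [Matrix.mulVec, dotProduct, colSub, Matrix.of_apply]
    rw [Finset.sum_coe_sort T (fun j => X i j * β j)]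
    symm
    apply Finset.sum_subset (Finset.subset_univ T)
    intro j _ hj
    have : β j = 0 := by
      by_contra h
      exact hj ((hsupp j).mp h)
    rw [this, mul_zero]
  simp only [Pi.add_apply, hb]
  ring
end
end

section
/- Let C > 0, let q > 0, w ≥ 0 and A > 0 be real numbers, and let β ∈ ℝ^p with ‖β‖₁ > 0. Assume (1/2)·‖β‖₁ ≤ A ≤ (3/2)·‖β‖₁ and that Δ := (C·A)² − (1+2C)·q·w ≥ 0, and define λ̃ = ( C·A − √Δ ) / ( (1+2C)·q ). Then w/(3·C·‖β‖₁) ≤ λ̃ ≤ 2·w/(C·‖β‖₁). (In the application, A = sgn(β_T)^t (X_T^t X_T)^{−1} X_T^t y, q = sgn(β_T)^t (X_T^t X_T)^{−1} sgn(β_T), and w = ‖P_{V_T^⊥} z‖₂², so λ̃ is the oracle relaxation parameter of Strategy (B).) -/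
open Real

noncomputable section

/-- Bounds on the oracle relaxation parameter of Strategy (B):
if `(1/2)‖β‖₁ ≤ A ≤ (3/2)‖β‖₁`, `Δ = (CA)² − (1+2C)qw ≥ 0` and
`λ̃ = (CA − √Δ)/((1+2C)q)`, then `w/(3C‖β‖₁) ≤ λ̃ ≤ 2w/(C‖β‖₁)`. -/
theorem oracle_lambda_strategyB_bounds
    (C q w A : ℝ) {p : ℕ} (β : Fin p → ℝ)
    (hC : 0 < C) (hq : 0 < q) (hw : 0 ≤ w) (hA : 0 < A)
    (hβ : 0 < ∑ j, |β j|)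
    (hA_low : (1 / 2) * ∑ j, |β j| ≤ A)
    (hA_up : A ≤ (3 / 2) * ∑ j, |β j|)
    (hΔ : 0 ≤ (C * A) ^ 2 - (1 + 2 * C) * q * w) :
    w / (3 * C * ∑ j, |β j|) ≤
      (C * A - Real.sqrt ((C * A) ^ 2 - (1 + 2 * C) * q * w)) / ((1 + 2 * C) * q) ∧
    (C * A - Real.sqrt ((C * A) ^ 2 - (1 + 2 * C) * q * w)) / ((1 + 2 * C) * q) ≤
      2 * w / (C * ∑ j, |β j|) := by
  have hK : 0 < (1 + 2 * C) * q := by positivity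
  have hCA : 0 < C * A := mul_pos hC hA
  generalize (∑ j, |β j|) = b at *
  set K := (1 + 2 * C) * q with hKdef
  have hs0 : 0 ≤ Real.sqrt ((C * A) ^ 2 - K * w) := Real.sqrt_nonneg _
  have hs2 : Real.sqrt ((C * A) ^ 2 - K * w) ^ 2 = (C * A) ^ 2 - K * w := Real.sq_sqrt hΔ
  have hs1 : Real.sqrt ((C * A) ^ 2 - K * w) ≤ C * A := by
    apply Real.sqrt_le_iff.mpr
    exact ⟨hCA.le, by nlinarith [mul_nonneg hK.le hw]⟩
  generalize Real.sqrt ((C * A) ^ 2 - K * w) = s at *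
  have h1 : C * b ≤ 2 * (C * A) := by nlinarith
  have h2 : 2 * (C * A) ≤ 3 * (C * b) := by nlinarith
  have hb : 0 < C * b := mul_pos hC hβ
  have key : (C * A - s) / K = w / (C * A + s) := by
    rw [div_eq_div_iff hK.ne' (by positivity)]
    linarith [hs2, sq_sub_sq (C * A) s]
  rw [key]
  constructor
  · apply div_le_div_of_nonneg_left hw (by positivity)
    linarith
  · rw [div_le_div_iff₀ (by positivity) hb]
    nlinarith [mul_nonneg hw hs0, mul_le_mul_of_nonneg_left h1 hw]
end
end

section
/- Let α > 0, r ∈ (0,1), C > 0, set κ = 4√(1+α) and m = 6κ·√(1+2C)/√(1−r). Let p ≥ 2 and s ≥ 1 be integers and let n be an integer satisfying n − s ≥ 8α·s·log p and n − s ≥ 4e·m²·s·log p. Then m·s·( √(n−s) + √(2α·log p) )/√s ≤ ( (n−s)/√(log p) )·( √(π·(n−s))/p^α )^{4/(n−s)}. (This is the inequality guaranteeing that s·𝖫 ≤ 𝖬, i.e. that the admissible range for ‖β‖₁ in Strategy (B) is nonempty.) -/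
open Real

noncomputable section

/-- Nonempty admissible range for `‖β‖₁` in Strategy (B): with
`κ = 4√(1+α)`, `m = 6κ√(1+2C)/√(1−r)`, and `n − s ≥ max(8α, 4em²) · s log p`, one has
`m s (√(n−s) + √(2α log p))/√s ≤ ((n−s)/√(log p)) (√(π(n−s))/p^α)^{4/(n−s)}`. -/
theorem strategyB_nonempty_range
    (α r C κ m : ℝ) (hα : 0 < α) (hr : r ∈ Set.Ioo (0 : ℝ) 1) (hC : 0 < C)
    (hκ : κ = 4 * Real.sqrt (1 + α))
    (hm : m = 6 * κ * Real.sqrt (1 + 2 * C) / Real.sqrt (1 - r))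
    (p s n : ℕ) (hp : 2 ≤ p) (hs : 1 ≤ s)
    (h1 : 8 * α * s * Real.log p ≤ (n : ℝ) - s)
    (h2 : 4 * Real.exp 1 * m ^ 2 * s * Real.log p ≤ (n : ℝ) - s) :
    m * s * ((Real.sqrt ((n : ℝ) - s) + Real.sqrt (2 * α * Real.log p)) / Real.sqrt s) ≤
      (((n : ℝ) - s) / Real.sqrt (Real.log p)) *
        (Real.sqrt (Real.pi * ((n : ℝ) - s)) / (p : ℝ) ^ α) ^ (4 / ((n : ℝ) - s)) := by
  have hm0 : 0 ≤ m := by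
    rw [hm, hκ]; positivity
  have hp2 : (2 : ℝ) ≤ p := by exact_mod_cast hp
  have hL : 0 < Real.log p := Real.log_pos (by linarith)
  have hs1 : (1 : ℝ) ≤ s := by exact_mod_cast hs
  have hd0 : 0 < (n : ℝ) - s := lt_of_lt_of_le (by positivity) h1
  have hd1 : 1 ≤ (n : ℝ) - s := by
    have h : s < n := by
      have : (s : ℝ) < n := by linarith
      exact_mod_cast this
    have h' : ((s + 1 : ℕ) : ℝ) ≤ n := by exact_mod_cast h
    push_cast at h'
    linarith
  generalize (n : ℝ) - s = d at *
  have hp0 : (0 : ℝ) < p := by linarith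
  have hLd : 8 * α * Real.log p ≤ d := by
    have h : 0 ≤ 8 * α * Real.log p * ((s : ℝ) - 1) :=
      mul_nonneg (by positivity) (by linarith)
    nlinarith
  -- lower bound for the power
  have hpow : Real.exp (-(1 / 2)) ≤ (Real.sqrt (Real.pi * d) / (p : ℝ) ^ α) ^ (4 / d) := by
    have hsq : 1 ≤ Real.sqrt (Real.pi * d) := by
      rw [Real.one_le_sqrt]
      nlinarith [Real.pi_gt_three]
    have hb : (p : ℝ) ^ (-α) ≤ Real.sqrt (Real.pi * d) / (p : ℝ) ^ α := by
      rw [Real.rpow_neg hp0.le, ← one_div]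
      gcongr
    refine le_trans ?_ (Real.rpow_le_rpow (by positivity) hb (by positivity))
    rw [← Real.rpow_mul hp0.le, Real.rpow_def_of_pos hp0]
    apply Real.exp_le_exp.mpr
    have h : Real.log p * (-α * (4 / d)) = -((4 * α * Real.log p) / d) := by
      field_simp
    rw [h, neg_le_neg_iff, div_le_iff₀ hd0]
    linarith
  have hsqrt2 : Real.sqrt (2 * α * Real.log p) ≤ Real.sqrt d / 2 := by
    rw [Real.sqrt_le_left (by positivity), div_pow, Real.sq_sqrt hd0.le]
    linarith
  have hA2 : Real.sqrt d ^ 2 = d := Real.sq_sqrt hd0.le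
  have hB2 : Real.sqrt (s : ℝ) ^ 2 = s := Real.sq_sqrt (by linarith)
  have hl2 : Real.sqrt (Real.log p) ^ 2 = Real.log p := Real.sq_sqrt hL.le
  have hA : 0 < Real.sqrt d := Real.sqrt_pos.mpr hd0
  have hB : 0 < Real.sqrt (s : ℝ) := Real.sqrt_pos.mpr (by linarith)
  have hl : 0 < Real.sqrt (Real.log p) := Real.sqrt_pos.mpr hL
  have hE2 : Real.exp (1 / 2) ^ 2 = Real.exp 1 := by
    rw [← Real.exp_nat_mul]; norm_num
  have hkey : 2 * Real.exp (1 / 2) * m * Real.sqrt s * Real.sqrt (Real.log p) ≤ Real.sqrt d := by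
    apply Real.le_sqrt_of_sq_le
    calc _ = 4 * (Real.exp (1 / 2) ^ 2) * m ^ 2 * (Real.sqrt (s : ℝ) ^ 2)
          * (Real.sqrt (Real.log p) ^ 2) := by ring
      _ ≤ d := by rw [hE2, hB2, hl2]; exact h2
  have hleft : m * s * ((Real.sqrt d + Real.sqrt (2 * α * Real.log p)) / Real.sqrt s) ≤
      m * Real.sqrt s * (2 * Real.sqrt d) := by
    have h : m * s * ((Real.sqrt d + Real.sqrt (2 * α * Real.log p)) / Real.sqrt s)
        = m * Real.sqrt s * (Real.sqrt d + Real.sqrt (2 * α * Real.log p)) := by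
      rw [mul_div_assoc', div_eq_iff hB.ne']
      nth_rewrite 1 [← hB2]
      ring
    rw [h]
    gcongr
    linarith
  refine hleft.trans (le_trans ?_ (mul_le_mul_of_nonneg_left hpow (by positivity)))
  rw [Real.exp_neg, ← div_eq_mul_inv, div_div, le_div_iff₀ (by positivity)]
  calc _ = (2 * Real.exp (1 / 2) * m * Real.sqrt s * Real.sqrt (Real.log p)) * Real.sqrt d := by
        ring
    _ ≤ Real.sqrt d * Real.sqrt d := by gcongr
    _ = d := Real.mul_self_sqrt hd0.le
end
end
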